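/- arXiv:2305.20021 — 6 statements merged into one kernel-verified Lean document; each statement's English description precedes it below -/
import Mathlib

section
/- Let d ≥ 1, k ∈ ℕ and θ ∈ (0,1]. There exists a constant C > 0, depending only on d, k and θ, such that for every Lebesgue-measurable set S ⊆ [0,1]^d with λ(S) ≥ θ and every polynomial p of coordinatewise degree at most k, one has ∫_{[0,1]^d} p² dλ ≤ C·∫_S p² dλ. -/
open MeasureTheory

namespace MvPolynomial

/-- The zero set of a nonzero real polynomial is Lebesgue-null. -/
theorem volume_zeros_eq_zero {n : ℕ} {p : MvPolynomial (Fin n) ℝ} (hp : p ≠ 0) :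
    volume {x : Fin n → ℝ | eval x p = 0} = 0 := by
  induction n with
  | zero =>
    obtain ⟨a, rfl⟩ := C_surjective (Fin 0) p
    have ha : a ≠ 0 := by
      rintro rfl
      exact hp C_0
    simp [ha]
  | succ n ih =>
    have hq : finSuccEquiv ℝ n p ≠ 0 := by simpa using hp
    have hc := ih (Polynomial.leadingCoeff_ne_zero.mpr hq)
    have hmp := (volume_preserving_piFinSuccAbove (fun _ : Fin (n + 1) => ℝ) 0).symm.comp
      (Measure.measurePreserving_swap (μ := (volume : Measure (Fin n → ℝ)))
        (ν := (volume : Measure ℝ)))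
    have hZ : MeasurableSet {x : Fin (n + 1) → ℝ | eval x p = 0} :=
      (isClosed_singleton.preimage (continuous_eval p)).measurableSet
    rw [← hmp.measure_preimage hZ.nullMeasurableSet]
    refine Measure.measure_prod_null_of_ae_null (hmp.measurable hZ) ?_
    filter_upwards [measure_eq_zero_iff_ae_notMem.mp hc] with s hs
    have hm : (finSuccEquiv ℝ n p).map (eval s) ≠ 0 := fun h => hs <| by
      simpa [Polynomial.coeff_map] using
        congrArg (fun q => q.coeff (finSuccEquiv ℝ n p).natDegree) h
    refine (Set.Finite.subset (Polynomial.finite_setOfPred_isRoot hm) ?_).measure_zero _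
    intro y hy
    have hy' : eval (Fin.cons y s : Fin (n + 1) → ℝ) p = 0 := by
      simpa [MeasurableEquiv.piFinSuccAbove, Fin.insertNthEquiv] using hy
    rwa [eval_eq_eval_mv_eval'] at hy'

end MvPolynomial

namespace ContinuousMap

variable {X : Type*} [TopologicalSpace X] [MeasurableSpace X] [BorelSpace X]
  {μ : Measure X} [IsFiniteMeasure μ]

/-- If `f` vanishes only on a null set, then its small sublevel sets have small measure. -/
theorem exists_measureReal_abs_le_lt (f : C(X, ℝ)) (hf : μ {x | f x = 0} = 0)
    {ε : ℝ} (hε : 0 < ε) : ∃ δ > 0, μ.real {x | |f x| ≤ δ} < ε := by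
  have hlim := tendsto_measure_iInter_atTop (μ := μ)
    (s := fun n : ℕ => {x | |f x| ≤ 1 / ((n : ℝ) + 1)})
    (fun n => (measurableSet_le (by fun_prop) measurable_const).nullMeasurableSet)
    (fun m n hmn x (hx : |f x| ≤ _) => hx.trans (by gcongr))
    ⟨0, measure_ne_top _ _⟩
  have hzero : μ (⋂ n : ℕ, {x | |f x| ≤ 1 / ((n : ℝ) + 1)}) = 0 := by
    refine measure_mono_null (fun x hx => ?_) hf
    simp only [Set.mem_iInter, Set.mem_ofPred_eq] at hx
    exact abs_nonpos_iff.mp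
      (ge_of_tendsto' tendsto_one_div_add_atTop_nhds_zero_nat hx)
  rw [hzero] at hlim
  obtain ⟨n, hn⟩ := (hlim.eventually (gt_mem_nhds (ENNReal.ofReal_pos.mpr hε))).exists
  refine ⟨1 / ((n : ℝ) + 1), by positivity, ?_⟩
  exact (ENNReal.lt_ofReal_iff_toReal_lt (measure_ne_top _ _)).mp hn

variable [CompactSpace X]

/-- On a finite-dimensional space of continuous functions whose nonzero members vanish only on
null sets, the sublevel sets relative to the sup norm are uniformly small. -/
theorem exists_forall_measureReal_abs_le_mul_norm_lt (E : Submodule ℝ C(X, ℝ))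
    [FiniteDimensional ℝ E] (hE : ∀ f ∈ E, f ≠ 0 → μ {x | f x = 0} = 0)
    {ε : ℝ} (hε : 0 < ε) :
    ∃ δ > 0, ∀ f ∈ E, f ≠ 0 → μ.real {x | |f x| ≤ δ * ‖f‖} < ε := by
  have := FiniteDimensional.proper_real E
  have key : ∃ δ > 0, ∀ f ∈ Metric.sphere (0 : E) 1, μ.real {x | |f.1 x| ≤ δ} < ε := by
    refine (isCompact_sphere (0 : E) 1).induction_on
      (p := fun s => ∃ δ > 0, ∀ f ∈ s, μ.real {x | |f.1 x| ≤ δ} < ε) ?_ ?_ ?_ ?_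
    · exact ⟨1, one_pos, by simp⟩
    · rintro s t hst ⟨δ, hδ, h⟩
      exact ⟨δ, hδ, fun f hf => h f (hst hf)⟩
    · rintro s t ⟨δ, hδ, h⟩ ⟨η, hη, h'⟩
      refine ⟨min δ η, lt_min hδ hη, ?_⟩
      rintro f (hf | hf)
      · refine lt_of_le_of_lt (measureReal_mono fun x hx => ?_) (h f hf)
        exact (show |f.1 x| ≤ min δ η from hx).trans (min_le_left _ _)
      · refine lt_of_le_of_lt (measureReal_mono fun x hx => ?_) (h' f hf)
        exact (show |f.1 x| ≤ min δ η from hx).trans (min_le_right _ _)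
    · intro f hf
      have hf0 : f.1 ≠ 0 := by
        intro h
        have hnorm : ‖f.1‖ = 1 := by simpa using hf
        simp [h] at hnorm
      obtain ⟨δ, hδ, h⟩ := exists_measureReal_abs_le_lt f.1 (hE _ f.2 hf0) hε
      refine ⟨_, mem_nhdsWithin_of_mem_nhds (Metric.ball_mem_nhds f (half_pos hδ)),
        δ / 2, half_pos hδ, fun g hg => ?_⟩
      refine (measureReal_mono fun x hx => ?_).trans_lt h
      have hx' : |g.1 x| ≤ δ / 2 := hx
      have hd : |g.1 x - f.1 x| ≤ δ / 2 :=
        (dist_apply_le_dist (f := g.1) (g := f.1) x).trans (Metric.mem_ball.mp hg).le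
      change |f.1 x| ≤ δ
      rw [abs_le] at *
      constructor <;> linarith
  obtain ⟨δ, hδ, h⟩ := key
  refine ⟨δ, hδ, fun f hf hf0 => ?_⟩
  have hn : 0 < ‖f‖ := norm_pos_iff.mpr hf0
  have hmem : (‖f‖⁻¹ • ⟨f, hf⟩ : E) ∈ Metric.sphere (0 : E) 1 := by
    simp [norm_smul, hn.ne']
  convert h _ hmem using 3
  ext x
  simp [abs_mul, inv_mul_le_iff₀ hn, mul_comm]

/-- Remez-type inequality for a finite-dimensional space of continuous functions whose nonzero
members vanish only on null sets. -/
theorem exists_integral_sq_le_mul_setIntegral_sq (E : Submodule ℝ C(X, ℝ))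
    [FiniteDimensional ℝ E] (hE : ∀ f ∈ E, f ≠ 0 → μ {x | f x = 0} = 0)
    {θ : ℝ} (hθ : 0 < θ) :
    ∃ C > 0, ∀ S : Set X, MeasurableSet S → θ ≤ μ.real S → ∀ f ∈ E,
      ∫ x, f x ^ 2 ∂μ ≤ C * ∫ x in S, f x ^ 2 ∂μ := by
  obtain ⟨δ, hδ, h⟩ := exists_forall_measureReal_abs_le_mul_norm_lt E hE (half_pos hθ)
  refine ⟨(μ.real Set.univ + 1) / (δ ^ 2 * (θ / 2)), by positivity, fun S hS hθS f hf => ?_⟩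
  rcases eq_or_ne f 0 with rfl | hf0
  · simp
  have hint : Integrable (fun x => f x ^ 2) μ :=
    Integrable.of_bound (by fun_prop) (‖f‖ ^ 2) (.of_forall fun x => by
      rw [norm_pow]
      gcongr
      exact f.norm_coe_le_norm x)
  have hupper : ∫ x, f x ^ 2 ∂μ ≤ μ.real Set.univ * ‖f‖ ^ 2 := by
    calc ∫ x, f x ^ 2 ∂μ ≤ ∫ _, ‖f‖ ^ 2 ∂μ := by
          refine integral_mono hint (integrable_const _) fun x => ?_
          exact sq_le_sq' (abs_le.mp (f.norm_coe_le_norm x)).1 (abs_le.mp (f.norm_coe_le_norm x)).2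
      _ = μ.real Set.univ * ‖f‖ ^ 2 := by simp
  set A := {x | |f x| ≤ δ * ‖f‖}
  have hA : MeasurableSet A := measurableSet_le (by fun_prop) measurable_const
  have hdiff : θ / 2 ≤ μ.real (S \ A) := by
    have h₁ : μ.real A < θ / 2 := h f hf hf0
    have h₂ := le_measureReal_sdiff (μ := μ) (s₁ := S) (s₂ := A)
    linarith
  have hlower : (δ * ‖f‖) ^ 2 * (θ / 2) ≤ ∫ x in S, f x ^ 2 ∂μ := by
    calc (δ * ‖f‖) ^ 2 * (θ / 2) ≤ (δ * ‖f‖) ^ 2 * μ.real (S \ A) := by gcongr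
      _ ≤ ∫ x in S \ A, f x ^ 2 ∂μ := by
          refine setIntegral_ge_of_const_le_real (hS.diff hA) (measure_ne_top _ _)
            (fun x hx => ?_) hint.integrableOn
          rw [← sq_abs (f x)]
          gcongr
          exact (not_le.mp hx.2).le
      _ ≤ ∫ x in S, f x ^ 2 ∂μ :=
          setIntegral_mono_set hint.integrableOn (.of_forall fun x => sq_nonneg _)
            (.of_forall fun _ hx => hx.1)
  calc ∫ x, f x ^ 2 ∂μ ≤ (μ.real Set.univ + 1) * ‖f‖ ^ 2 :=
        hupper.trans (by gcongr; linarith)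
    _ = (μ.real Set.univ + 1) / (δ ^ 2 * (θ / 2)) * ((δ * ‖f‖) ^ 2 * (θ / 2)) := by
        field_simp
    _ ≤ _ := by gcongr

end ContinuousMap

/-- Remez-type inequality: for measurable `S ⊆ [0,1]^d` of measure at least `θ`,
the `L²`-norm on the unit cube of any polynomial of coordinatewise degree at most `k` is
controlled by its `L²`-norm on `S`, with a constant depending only on `d`, `k`, `θ`. -/
theorem stmt_1 (d k : ℕ) (hd : 1 ≤ d) (θ : ℝ) (hθ0 : 0 < θ) (hθ1 : θ ≤ 1) :
    ∃ C : ℝ, 0 < C ∧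
      ∀ S : Set (Fin d → ℝ), MeasurableSet S →
        S ⊆ {z : Fin d → ℝ | ∀ i, z i ∈ Set.Icc (0 : ℝ) 1} →
        ENNReal.ofReal θ ≤ volume S →
        ∀ p : MvPolynomial (Fin d) ℝ, (∀ i, p.degreeOf i ≤ k) →
          ∫ x in {z : Fin d → ℝ | ∀ i, z i ∈ Set.Icc (0 : ℝ) 1},
              (MvPolynomial.eval x p) ^ 2
            ≤ C * ∫ x in S, (MvPolynomial.eval x p) ^ 2 := by
  set Q : Set (Fin d → ℝ) := {z | ∀ i, z i ∈ Set.Icc (0 : ℝ) 1} with hQ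
  have hQc : IsCompact Q := isCompact_pi_infinite fun _ => isCompact_Icc
  have hQm : MeasurableSet Q := hQc.measurableSet
  have : CompactSpace Q := isCompact_iff_compactSpace.mp hQc
  let μ : Measure Q := volume.comap Subtype.val
  have hμ : ∀ t : Set Q, μ t = volume (Subtype.val '' t) := comap_subtype_coe_apply hQm volume
  have : IsFiniteMeasure μ := ⟨by
    rw [hμ, Set.image_univ, Subtype.range_coe]
    exact hQc.measure_lt_top⟩
  let T : MvPolynomial (Fin d) ℝ →ₗ[ℝ] C(Q, ℝ) :=
    { toFun := fun p => ⟨fun x => MvPolynomial.eval x.1 p,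
        (MvPolynomial.continuous_eval p).comp continuous_subtype_val⟩
      map_add' := fun p q => by ext; simp
      map_smul' := fun c p => by ext; simp [MvPolynomial.smul_eval] }
  obtain ⟨C, hC, h⟩ := ContinuousMap.exists_integral_sq_le_mul_setIntegral_sq (μ := μ)
    ((MvPolynomial.restrictDegree (Fin d) ℝ k).map T) (by
      rintro _ ⟨p, -, rfl⟩ hp
      rw [hμ]
      refine measure_mono_null ?_
        (MvPolynomial.volume_zeros_eq_zero (p := p) fun h => hp (by simp [h]))
      rintro _ ⟨x, hx, rfl⟩
      exact hx) hθ0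
  refine ⟨C, hC, fun S hS hSQ hθS p hp => ?_⟩
  have hval : Subtype.val '' (Subtype.val ⁻¹' S : Set Q) = S := by
    rw [Subtype.image_preimage_coe, Set.inter_eq_right.mpr hSQ]
  have hSm : θ ≤ μ.real (Subtype.val ⁻¹' S) := by
    rw [measureReal_def, ← ENNReal.ofReal_le_iff_le_toReal (measure_ne_top _ _), hμ, hval]
    exact hθS
  have key := h _ (measurable_subtype_coe hS) hSm (T p) (Submodule.mem_map_of_mem <| by
    rw [MvPolynomial.mem_restrictDegree]
    exact fun s hs i => MvPolynomial.degreeOf_le_iff.mp (hp i) s hs)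
  have hfull : ∫ x, T p x ^ 2 ∂μ = ∫ x in Q, MvPolynomial.eval x p ^ 2 :=
    integral_subtype_comap hQm fun x => MvPolynomial.eval x p ^ 2
  have hpart : ∫ x in Subtype.val ⁻¹' S, T p x ^ 2 ∂μ = ∫ x in S, MvPolynomial.eval x p ^ 2 := by
    have := (MeasurableEmbedding.subtype_coe hQm).setIntegral_map (μ := μ)
      (fun x => MvPolynomial.eval x p ^ 2) S
    rw [map_comap_subtype_coe hQm, Measure.restrict_restrict hS,
      Set.inter_eq_left.mpr hSQ] at this
    exact this.symm
  rwa [hfull, hpart] at key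
end

section
/- Let d ≥ 2, k ∈ ℕ and L ≥ 0. There exists a constant C > 0, depending only on d, k and L, such that for every L-Lipschitz function f : ℝ^{d−1} → ℝ, every h > 0, every axis-aligned cube K ⊆ ℝ^d of side h, and every polynomial p of coordinatewise degree at most k, one has ∫_{Γ_f ∩ K} p² dμH^{d−1} ≤ C·h^{−1}·∫_K p² dλ. -/
open MeasureTheory

/-- On a finite-dimensional space of continuous functions that are determined by their values on
the interior of a compact set, the supremum norm is controlled by the `L²`-norm. -/
theorem exists_sq_le_mul_setIntegral_sq {X ι : Type*} [TopologicalSpace X] [T2Space X]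
    [FirstCountableTopology X] [LocallyCompactSpace X] [MeasurableSpace X] [OpensMeasurableSpace X]
    (μ : Measure X) [IsFiniteMeasureOnCompacts μ] [μ.IsOpenPosMeasure]
    [Fintype ι] {φ : ι → X → ℝ} (hφ : ∀ i, Continuous (φ i)) {s : Set X} (hs : IsCompact s)
    (hind : ∀ a : ι → ℝ, (∀ z ∈ interior s, ∑ i, a i * φ i z = 0) → a = 0) :
    ∃ C : ℝ, 0 < C ∧ ∀ a : ι → ℝ, ∀ z ∈ s,
      (∑ i, a i * φ i z) ^ 2 ≤ C * ∫ y in s, (∑ i, a i * φ i y) ^ 2 ∂μ := by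
  have hcont : Continuous (Function.uncurry
      fun (a : ι → ℝ) (z : X) => (∑ i, a i * φ i z) ^ 2) := by
    simp only [Function.uncurry_def]
    fun_prop
  have hQ : Continuous fun a : ι → ℝ => ∫ y in s, (∑ i, a i * φ i y) ^ 2 ∂μ :=
    continuous_parametric_integral_of_continuous hcont hs
  have hS : IsCompact (Metric.sphere (0 : ι → ℝ) 1) := isCompact_sphere _ _
  obtain ⟨B, hB⟩ := (hS.prod hs).exists_bound_of_continuousOn hcont.continuousOn
  have hpos : ∀ a ∈ Metric.sphere (0 : ι → ℝ) 1, 0 < ∫ y in s, (∑ i, a i * φ i y) ^ 2 ∂μ := by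
    intro a ha
    have hca : Continuous fun y => (∑ i, a i * φ i y) ^ 2 := by fun_prop
    refine lt_of_le_of_ne (integral_nonneg fun y => sq_nonneg _) fun h0 => ?_
    have hae := (setIntegral_eq_zero_iff_of_nonneg_ae
      (Filter.Eventually.of_forall fun y => sq_nonneg _)
      (hca.continuousOn.integrableOn_compact hs)).1 h0.symm
    have heq := Measure.eqOn_open_of_ae_eq (ae_restrict_of_ae_restrict_of_subset
      interior_subset hae) isOpen_interior hca.continuousOn continuousOn_const
    have : a = 0 := hind a fun z hz => by simpa using heq hz
    simp [this] at ha
  obtain ⟨m, hm, hmle⟩ := hS.exists_forall_le' hQ.continuousOn hpos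
  refine ⟨(|B| + 1) / m, by positivity, fun a z hz => ?_⟩
  rcases eq_or_ne a 0 with rfl | ha
  · simp
  have hn : 0 < ‖a‖ := norm_pos_iff.2 ha
  set b : ι → ℝ := ‖a‖⁻¹ • a with hb
  have hbS : b ∈ Metric.sphere (0 : ι → ℝ) 1 := by
    simp [hb, norm_smul, hn.ne']
  have hab : ∀ y, (∑ i, a i * φ i y) ^ 2 = ‖a‖ ^ 2 * (∑ i, b i * φ i y) ^ 2 := by
    intro y
    rw [← mul_pow, Finset.mul_sum]
    congr 1
    refine Finset.sum_congr rfl fun i _ => ?_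
    simp only [hb, Pi.smul_apply, smul_eq_mul]
    field_simp
  simp_rw [hab]
  rw [integral_const_mul, mul_left_comm]
  gcongr
  have h1 : (∑ i, b i * φ i z) ^ 2 ≤ |B| + 1 := by
    have := (le_abs_self _).trans (hB (b, z) ⟨hbS, hz⟩)
    simp only [Function.uncurry_apply_pair] at this
    linarith [le_abs_self B]
  have h2 := hmle b hbS
  calc (∑ i, b i * φ i z) ^ 2 ≤ (|B| + 1) / m * m := by rwa [div_mul_cancel₀ _ hm.ne']
    _ ≤ _ := by gcongr

/-- Composing a polynomial of coordinatewise degree at most `k` with a homothety gives a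
combination of monomials of coordinatewise degree at most `k`. -/
theorem MvPolynomial.exists_eval_add_mul_eq_sum {σ R : Type*} [Fintype σ] [DecidableEq σ]
    [CommRing R] {k : ℕ} {p : MvPolynomial σ R} (hp : ∀ i, p.degreeOf i ≤ k) (x₀ : σ → R) (h : R) :
    ∃ a : (σ → Fin (k + 1)) → R, ∀ z : σ → R,
      MvPolynomial.eval (fun i => x₀ i + h * z i) p = ∑ m, a m * ∏ i, z i ^ (m i : ℕ) := by
  let q (i : σ) (n : ℕ) : Polynomial R := (Polynomial.C (x₀ i) + Polynomial.C h * Polynomial.X) ^ n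
  have hq : ∀ i n z, (q i n).eval z = (x₀ i + h * z) ^ n := by simp [q]
  have hdeg : ∀ i n, n ≤ k → (q i n).natDegree < k + 1 := by
    intro i n hn
    have h1 : (Polynomial.C (x₀ i) + Polynomial.C h * Polynomial.X).natDegree ≤ 1 := by
      compute_degree
    have := Polynomial.natDegree_pow_le_of_le n h1
    simp only [q]
    omega
  refine ⟨fun m => ∑ e ∈ p.support, p.coeff e * ∏ i, (q i (e i)).coeff (m i), fun z => ?_⟩
  rw [MvPolynomial.eval_eq']
  simp_rw [Finset.sum_mul]
  rw [Finset.sum_comm]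
  refine Finset.sum_congr rfl fun e he => ?_
  have hi : ∀ i, (x₀ i + h * z i) ^ e i =
      ∑ j : Fin (k + 1), (q i (e i)).coeff j * z i ^ (j : ℕ) := by
    intro i
    rw [← hq, Polynomial.eval_eq_sum_range' (hdeg i _ ?_), Finset.sum_range]
    exact (MvPolynomial.degreeOf_le_iff.1 (hp i)) e he
  simp_rw [hi]
  rw [Finset.prod_univ_sum, Fintype.piFinset_univ, Finset.mul_sum]
  refine Finset.sum_congr rfl fun m _ => ?_
  rw [Finset.prod_mul_distrib, mul_assoc]

/-- Monomials of coordinatewise degree at most `k` are linearly independent as functions on any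
product of infinite sets. -/
theorem eq_zero_of_sum_mul_prod_pow_eq_zero {σ R : Type*} [Fintype σ] [DecidableEq σ]
    [CommRing R] [IsDomain R] {k : ℕ} {s : σ → Set R} (hs : ∀ i, (s i).Infinite)
    {a : (σ → Fin (k + 1)) → R}
    (ha : ∀ z ∈ Set.pi .univ s, ∑ m, a m * ∏ i, z i ^ (m i : ℕ) = 0) : a = 0 := by
  let e (m : σ → Fin (k + 1)) : σ →₀ ℕ := Finsupp.equivFunOnFinite.symm fun i => (m i : ℕ)
  have he : Function.Injective e := fun m m' h => by
    funext i
    have := DFunLike.congr_fun h i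
    exact Fin.ext (by simpa [e] using this)
  have hP : ∑ m, MvPolynomial.monomial (e m) (a m) = 0 := by
    refine MvPolynomial.funext_set s hs fun z hz => ?_
    rw [map_sum, map_zero, ← ha z hz]
    refine Finset.sum_congr rfl fun m _ => ?_
    rw [MvPolynomial.eval_monomial, Finsupp.prod_fintype _ _ (by simp)]
    simp [e]
  funext m
  have := congrArg (MvPolynomial.coeff (e m)) hP
  simpa [MvPolynomial.coeff_sum, MvPolynomial.coeff_monomial, he.eq_iff] using this

/-- The axis-aligned cube with lowest corner `x₀` and side `h`. -/
def euclideanCube {ι : Type*} (x₀ : EuclideanSpace ℝ ι) (h : ℝ) : Set (EuclideanSpace ℝ ι) :=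
  {y | ∀ i, y i ∈ Set.Icc (x₀ i) (x₀ i + h)}

theorem isCompact_euclideanCube {ι : Type*} [Fintype ι] (x₀ : EuclideanSpace ℝ ι) (h : ℝ) :
    IsCompact (euclideanCube x₀ h) := by
  have : euclideanCube x₀ h = (EuclideanSpace.equiv ι ℝ).toHomeomorph ⁻¹'
      Set.pi .univ fun i => Set.Icc (x₀ i) (x₀ i + h) := by
    ext y
    simp only [Set.mem_preimage, Set.mem_pi, Set.mem_univ, true_imp_iff]
    rfl
  rw [this, Homeomorph.isCompact_preimage]
  exact isCompact_univ_pi fun i => isCompact_Icc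

theorem mem_interior_euclideanCube {ι : Type*} [Fintype ι] {x₀ : EuclideanSpace ℝ ι} {h : ℝ}
    {y : EuclideanSpace ℝ ι} (hy : ∀ i, y i ∈ Set.Ioo (x₀ i) (x₀ i + h)) :
    y ∈ interior (euclideanCube x₀ h) := by
  refine interior_maximal (s := euclideanCube x₀ h)
    (t := {y | ∀ i, y i ∈ Set.Ioo (x₀ i) (x₀ i + h)})
    (fun y hy i => Set.Ioo_subset_Icc_self (hy i)) ?_ hy
  simp only [Set.ofPred_forall]
  exact isOpen_iInter_of_finite fun i => isOpen_Ioo.preimage (by fun_prop)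

theorem setIntegral_euclideanCube_zero_one_comp {ι : Type*} [Fintype ι] (x₀ : EuclideanSpace ℝ ι)
    {h : ℝ} (hh : 0 < h) (F : EuclideanSpace ℝ ι → ℝ) :
    ∫ z in euclideanCube (0 : EuclideanSpace ℝ ι) 1, F (x₀ + h • z) =
      (h ^ Fintype.card ι)⁻¹ * ∫ y in euclideanCube x₀ h, F y := by
  have hmem : ∀ z : EuclideanSpace ℝ ι,
      z ∈ euclideanCube (0 : EuclideanSpace ℝ ι) 1 ↔ x₀ + h • z ∈ euclideanCube x₀ h := by
    intro z
    refine forall_congr' fun i => ?_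
    simp [Set.mem_Icc, hh]
  rw [← integral_indicator (isCompact_euclideanCube _ _).measurableSet,
    ← integral_indicator (isCompact_euclideanCube _ _).measurableSet]
  have hind : (fun z => (euclideanCube (0 : EuclideanSpace ℝ ι) 1).indicator
      (fun z => F (x₀ + h • z)) z) =
      fun z => (fun w => (euclideanCube x₀ h).indicator F (x₀ + w)) (h • z) := by
    funext z
    by_cases hz : z ∈ euclideanCube (0 : EuclideanSpace ℝ ι) 1
    · simp [Set.indicator_of_mem hz, Set.indicator_of_mem ((hmem z).1 hz)]
    · simp [Set.indicator_of_notMem hz, Set.indicator_of_notMem (fun H => hz ((hmem z).2 H))]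
  rw [hind, Measure.integral_comp_smul volume
      (fun w => (euclideanCube x₀ h).indicator F (x₀ + w)), integral_add_left_eq_self,
    finrank_euclideanSpace, abs_of_pos (by positivity), smul_eq_mul]

/-- Inverse inequality: on a cube, the maximum of a polynomial of coordinatewise degree at most
`k` is controlled by its `L²`-norm. -/
theorem exists_eval_sq_le_setIntegral_euclideanCube (ι : Type*) [Fintype ι] (k : ℕ) :
    ∃ C : ℝ, 0 < C ∧ ∀ h : ℝ, 0 < h → ∀ x₀ : EuclideanSpace ℝ ι, ∀ p : MvPolynomial ι ℝ,
      (∀ i, p.degreeOf i ≤ k) → ∀ y ∈ euclideanCube x₀ h,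
        (MvPolynomial.eval (fun i => y i) p) ^ 2 ≤
          C * (h ^ Fintype.card ι)⁻¹ *
            ∫ y in euclideanCube x₀ h, (MvPolynomial.eval (fun i => y i) p) ^ 2 := by
  classical
  obtain ⟨C, hC, hle⟩ := exists_sq_le_mul_setIntegral_sq (X := EuclideanSpace ℝ ι)
    (ι := ι → Fin (k + 1)) volume
    (φ := fun m z => ∏ i, z i ^ (m i : ℕ)) (fun m => by fun_prop)
    (isCompact_euclideanCube 0 1) (fun a ha => by
      refine eq_zero_of_sum_mul_prod_pow_eq_zero (s := fun _ => Set.Ioo 0 1)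
        (fun _ => Set.Ioo_infinite one_pos) fun z hz => ?_
      refine ha (WithLp.toLp 2 z) (mem_interior_euclideanCube fun i => ?_)
      simpa using hz i trivial)
  refine ⟨C, hC, fun h hh x₀ p hp y hy => ?_⟩
  obtain ⟨a, ha⟩ := MvPolynomial.exists_eval_add_mul_eq_sum hp x₀ h
  have key := setIntegral_euclideanCube_zero_one_comp x₀ hh
    fun y => (MvPolynomial.eval (fun i => y i) p) ^ 2
  have ha' : ∀ z : EuclideanSpace ℝ ι, MvPolynomial.eval (fun i => (x₀ + h • z) i) p =
      ∑ m, a m * ∏ i, z i ^ (m i : ℕ) := fun z => ha z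
  simp_rw [ha'] at key
  rw [mul_assoc, ← key]
  have hyz : y = x₀ + h • (h⁻¹ • (y - x₀)) := by
    rw [smul_inv_smul₀ hh.ne', add_sub_cancel]
  rw [hyz, ha']
  refine hle a _ fun i => ?_
  obtain ⟨h1, h2⟩ := hy i
  simp only [PiLp.smul_apply, PiLp.sub_apply, PiLp.zero_apply, smul_eq_mul, zero_add, Set.mem_Icc]
  constructor
  · have : 0 ≤ y i - x₀ i := by linarith
    positivity
  · rw [inv_mul_le_iff₀ hh]
    linarith

open scoped NNReal in
/-- The part of an `L`-Lipschitz graph inside a cube of side `h` in `ℝ^d` has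
`(d - 1)`-dimensional measure at most a constant times `h ^ (d - 1)`. -/
theorem exists_hausdorffMeasure_graph_inter_euclideanCube_le {d : ℕ} (hd : 2 ≤ d)
    {j : Fin d} (hj : (j : ℕ) = d - 1) (L : ℝ≥0) :
    ∃ A : ℝ≥0, 0 < A ∧ ∀ f : EuclideanSpace ℝ (Fin (d - 1)) → ℝ, LipschitzWith L f →
      ∀ h : ℝ≥0, ∀ x₀ : EuclideanSpace ℝ (Fin d), 0 < h →
        μH[(d : ℝ) - 1] ({y : EuclideanSpace ℝ (Fin d) |
          ∃ x : EuclideanSpace ℝ (Fin (d - 1)),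
            (∀ i : Fin (d - 1), y (Fin.castLE (Nat.sub_le d 1) i) = x i) ∧
            y j = f x} ∩ euclideanCube x₀ h) ≤
          ((A * h ^ (d - 1) : ℝ≥0) : ENNReal) := by
  have hdim : (d : ℝ) - 1 = ((d - 1 : ℕ) : ℝ) := by
    rw [Nat.cast_sub (by omega), Nat.cast_one]
  obtain ⟨c, hc⟩ : ∃ c : ℝ≥0, LipschitzWith c
      (WithLp.toLp 2 : (Fin (d - 1) → ℝ) → EuclideanSpace ℝ (Fin (d - 1))) :=
    ⟨_, PiLp.lipschitzWith_toLp 2 _⟩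
  obtain ⟨c', hc'⟩ : ∃ c : ℝ≥0, LipschitzWith c
      (WithLp.toLp 2 : (Fin d → ℝ) → EuclideanSpace ℝ (Fin d)) :=
    ⟨_, PiLp.lipschitzWith_toLp 2 _⟩
  refine ⟨((c' + 1) * (1 + L * c)) ^ (d - 1), by positivity, fun f hf h x₀ hh => ?_⟩
  let e (x : Fin (d - 1) → ℝ) : Fin (d - 1) → ℝ :=
    fun i => x₀ (Fin.castLE (Nat.sub_le d 1) i) + h * x i
  have he : LipschitzWith h e := by
    refine LipschitzWith.of_dist_le_mul fun x y => ?_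
    refine (dist_pi_le_iff (by positivity)).2 fun i => ?_
    simp only [e, dist_add_left, Real.dist_eq, ← mul_sub, abs_mul, NNReal.abs_eq]
    gcongr
    rw [← Real.dist_eq]
    exact dist_le_pi_dist x y i
  let g (x : Fin (d - 1) → ℝ) : Fin d → ℝ :=
    fun i => if hi : (i : ℕ) < d - 1 then e x ⟨i, hi⟩ else f (WithLp.toLp 2 (e x))
  have hg : LipschitzWith ((1 + L * c) * h) g := by
    have h2 := hf.comp (hc.comp he)
    refine LipschitzWith.of_dist_le_mul fun x y => ?_
    refine (dist_pi_le_iff (by positivity)).2 fun i => ?_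
    by_cases hi : (i : ℕ) < d - 1
    · simp only [g, hi, dite_true]
      refine (dist_le_pi_dist (e x) (e y) _).trans ((he.dist_le_mul x y).trans ?_)
      gcongr
      exact le_mul_of_one_le_left (by positivity) (by simp)
    · simp only [g, hi, dite_false]
      refine (h2.dist_le_mul x y).trans (mul_le_mul_of_nonneg_right ?_ dist_nonneg)
      rw [← mul_assoc, NNReal.coe_le_coe]
      gcongr
      exact le_add_self
  have hG := (hc'.comp hg)
  have hsub : ({y : EuclideanSpace ℝ (Fin d) | ∃ x : EuclideanSpace ℝ (Fin (d - 1)),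
        (∀ i : Fin (d - 1), y (Fin.castLE (Nat.sub_le d 1) i) = x i) ∧
        y j = f x} ∩ euclideanCube x₀ h) ⊆
      (WithLp.toLp 2 ∘ g) '' Set.Icc 0 1 := by
    rintro y ⟨⟨x, hx, hfx⟩, hy⟩
    have hh' : (0 : ℝ) < h := hh
    have hex : e (fun i => (h : ℝ)⁻¹ * (x i - x₀ (Fin.castLE (Nat.sub_le d 1) i))) = x := by
      funext i
      simp only [e]
      field_simp
      ring
    refine ⟨fun i => (h : ℝ)⁻¹ * (x i - x₀ (Fin.castLE (Nat.sub_le d 1) i)), ⟨?_, ?_⟩, ?_⟩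
    · intro i
      have := (hy (Fin.castLE (Nat.sub_le d 1) i)).1
      rw [hx] at this
      exact mul_nonneg (by positivity) (by linarith)
    · intro i
      have := (hy (Fin.castLE (Nat.sub_le d 1) i)).2
      rw [hx] at this
      simp only [Pi.one_apply]
      rw [inv_mul_le_iff₀ hh']
      linarith
    · ext i
      simp only [Function.comp_apply, g, hex]
      by_cases hi : (i : ℕ) < d - 1
      · simp only [hi, dite_true]
        rw [← hx]
        rfl
      · simp only [hi, dite_false]
        have : i = j := Fin.ext (by omega)
        rw [this, hfx]
  refine (measure_mono hsub).trans ((hG.hausdorffMeasure_image_le (by rw [hdim]; positivity)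
    _).trans ?_)
  have hvol : μH[(d : ℝ) - 1] (Set.Icc (0 : Fin (d - 1) → ℝ) 1) = 1 := by
    have := hausdorffMeasure_pi_real (ι := Fin (d - 1))
    rw [Fintype.card_fin] at this
    rw [hdim, this, Real.volume_Icc_pi]
    simp
  rw [hvol, mul_one, hdim, ENNReal.rpow_natCast, ← ENNReal.coe_pow, ENNReal.coe_le_coe,
    ← mul_pow, mul_assoc (c' + 1)]
  gcongr
  simp

/-- discrete trace inequality: for a Lipschitz graph `Γ_f` cutting an axis-aligned
cube `K` of side `h`, the interface `L²`-norm of a polynomial of coordinatewise degree at most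
`k` is bounded by `C · h⁻¹` times its `L²`-norm on `K`. -/
theorem stmt_3 (d k : ℕ) (hd : 2 ≤ d) (L : ℝ) (hL : 0 ≤ L) :
    ∃ C : ℝ, 0 < C ∧
      ∀ f : EuclideanSpace ℝ (Fin (d - 1)) → ℝ,
        (∀ x y : EuclideanSpace ℝ (Fin (d - 1)), |f x - f y| ≤ L * dist x y) →
        ∀ h : ℝ, 0 < h → ∀ x₀ : EuclideanSpace ℝ (Fin d),
          ∀ p : MvPolynomial (Fin d) ℝ, (∀ i, p.degreeOf i ≤ k) →
            ∫ y in
                ({y : EuclideanSpace ℝ (Fin d) |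
                    ∃ x : EuclideanSpace ℝ (Fin (d - 1)),
                      (∀ i : Fin (d - 1), y (Fin.castLE (Nat.sub_le d 1) i) = x i) ∧
                      y ⟨d - 1, by omega⟩ = f x} ∩
                  {y : EuclideanSpace ℝ (Fin d) | ∀ i, y i ∈ Set.Icc (x₀ i) (x₀ i + h)}),
                (MvPolynomial.eval (fun i => y i) p) ^ 2 ∂(μH[(d : ℝ) - 1])
              ≤ C / h *
                  ∫ y in {y : EuclideanSpace ℝ (Fin d) | ∀ i, y i ∈ Set.Icc (x₀ i) (x₀ i + h)},
                    (MvPolynomial.eval (fun i => y i) p) ^ 2 := by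
  lift L to NNReal using hL
  obtain ⟨B, hB, hBle⟩ := exists_eval_sq_le_setIntegral_euclideanCube (Fin d) k
  obtain ⟨A, hA, hAle⟩ :=
    exists_hausdorffMeasure_graph_inter_euclideanCube_le hd (j := ⟨d - 1, by omega⟩) rfl L
  refine ⟨B * A, by positivity, fun f hf h hh x₀ p hp => ?_⟩
  lift h to NNReal using hh.le
  have hmeas := hAle f (LipschitzWith.of_dist_le_mul hf) h x₀ (NNReal.coe_pos.1 hh)
  have hreal := ENNReal.toReal_mono ENNReal.coe_ne_top hmeas
  change _ ≤ B * A / h * ∫ y in euclideanCube x₀ h, (MvPolynomial.eval (fun i => y i) p) ^ 2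
  set I := ∫ y in euclideanCube x₀ h, (MvPolynomial.eval (fun i => y i) p) ^ 2
  have hI : 0 ≤ I := integral_nonneg fun y => sq_nonneg _
  have hint := norm_setIntegral_le_of_norm_le_const
    (C := B * ((h : ℝ) ^ Fintype.card (Fin d))⁻¹ * I)
    (f := fun y : EuclideanSpace ℝ (Fin d) => (MvPolynomial.eval (fun i => y i) p) ^ 2)
    (hmeas.trans_lt ENNReal.coe_lt_top) fun y hy => by
      rw [Real.norm_of_nonneg (sq_nonneg _)]
      exact hBle h hh x₀ p hp y hy.2
  refine (le_abs_self _).trans (hint.trans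
    ((mul_le_mul_of_nonneg_left hreal (by positivity)).trans_eq ?_))
  have hpow : (h : ℝ) ^ d = h ^ (d - 1) * h := by
    rw [← pow_succ, Nat.sub_add_cancel (by omega)]
  rw [Fintype.card_fin, hpow, ENNReal.coe_toReal, NNReal.coe_mul, NNReal.coe_pow]
  field_simp
end

section
/- Let d ≥ 1, k ∈ ℕ, θ ∈ (0,1] and R ≥ 0. There exists a constant C > 0, depending only on d, k, θ and R, such that for every h > 0, all axis-aligned cubes K, K' ⊆ ℝ^d of side h with dist(K, K') ≤ R·h, every Lebesgue-measurable set S ⊆ K' with λ(S) ≥ θ·h^d, and every polynomial p of coordinatewise degree at most k, one has ∫_K p² dλ ≤ C·∫_S p² dλ. -/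
open MeasureTheory

namespace MvPolynomial

theorem degreeOf_bind₁_C_add_C_mul_X_le {σ R : Type*} [CommRing R] [Nontrivial R]
    (b : σ → R) (h : R) (p : MvPolynomial σ R) (i : σ) :
    (bind₁ (fun j => C (b j) + C h * X j) p).degreeOf i ≤ p.degreeOf i := by
  classical
  rw [bind₁, aeval_def, eval₂_eq]
  refine (degreeOf_sum_le _ _ _).trans (Finset.sup_le fun s hs => ?_)
  refine (degreeOf_C_mul_le _ _ _).trans ((degreeOf_prod_le _ _ _).trans ?_)
  refine le_trans ?_ (monomial_le_degreeOf i hs)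
  have key : ∀ j ∈ s.support, degreeOf i ((C (b j) + C h * X j : MvPolynomial σ R) ^ s j)
      ≤ if j = i then s i else 0 := by
    intro j _
    have h1 : degreeOf i (C (b j) + C h * X j : MvPolynomial σ R) ≤ if j = i then 1 else 0 := by
      refine (degreeOf_add_le _ _ _).trans (max_le (by simp) ?_)
      refine (degreeOf_C_mul_le _ _ _).trans ?_
      rw [degreeOf_X]
      simp [eq_comm]
    refine (degreeOf_pow_le _ _ _).trans ((Nat.mul_le_mul_left _ h1).trans ?_)
    split_ifs with hji
    · simp [hji]
    · simp
  refine (Finset.sum_le_sum key).trans ?_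
  rw [Finset.sum_ite_eq']
  split_ifs <;> simp

theorem eval_bind₁_C_add_C_mul_X {σ R : Type*} [CommRing R]
    (b : σ → R) (h : R) (p : MvPolynomial σ R) (x : σ → R) :
    eval x (bind₁ (fun j => C (b j) + C h * X j) p) = eval (fun j => b j + h * x j) p := by
  rw [eval, eval₂Hom_bind₁]
  simp only [map_add, map_mul, eval₂Hom_C, eval₂Hom_X', RingHom.id_apply]
  rfl

end MvPolynomial

section FiniteFamily

variable {X ι : Type*} [TopologicalSpace X] [Fintype ι]

theorem exists_abs_sum_mul_le_of_isCompact {f : ι → X → ℝ} (hf : ∀ i, Continuous (f i))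
    {L : Set X} (hL : IsCompact L) :
    ∃ M : ℝ, 0 < M ∧ ∀ c : ι → ℝ, ∀ x ∈ L, |∑ i, c i * f i x| ≤ ‖c‖ * M := by
  obtain ⟨M, hM⟩ := hL.exists_bound_of_continuousOn (f := fun x => ∑ i, |f i x|)
    (by fun_prop)
  refine ⟨max M 1, by positivity, fun c x hx => ?_⟩
  calc |∑ i, c i * f i x| ≤ ∑ i, ‖c‖ * |f i x| := by
        refine (Finset.abs_sum_le_sum_abs _ _).trans (Finset.sum_le_sum fun i _ => ?_)
        rw [abs_mul]
        gcongr
        exact norm_le_pi_norm c i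
    _ = ‖c‖ * ∑ i, |f i x| := by rw [Finset.mul_sum]
    _ ≤ ‖c‖ * max M 1 := by
        gcongr
        exact (le_abs_self _).trans ((hM x hx).trans (le_max_left _ _))

variable [MeasurableSpace X] [BorelSpace X] {μ : Measure X} [IsFiniteMeasureOnCompacts μ]
  [T2Space X]

theorem exists_measure_abs_le_lt_of_isCompact {g : X → ℝ} (hg : Continuous g) {Q : Set X}
    (hQ : IsCompact Q) (hzero : μ {x ∈ Q | g x = 0} = 0) {θ : ENNReal} (hθ : 0 < θ) :
    ∃ ε : ℝ, 0 < ε ∧ μ {x ∈ Q | |g x| ≤ ε} < θ := by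
  have hmeas : ∀ ε : ℝ, MeasurableSet {x ∈ Q | |g x| ≤ ε} := fun ε =>
    hQ.measurableSet.inter (isClosed_le hg.abs continuous_const).measurableSet
  have hinter : ⋂ ε > (0 : ℝ), {x ∈ Q | |g x| ≤ ε} = {x ∈ Q | g x = 0} := by
    ext x
    simp only [Set.mem_iInter, Set.mem_ofPred_eq]
    refine ⟨fun hx => ⟨(hx 1 one_pos).1, ?_⟩, fun hx ε hε => ⟨hx.1, by simp [hx.2, hε.le]⟩⟩
    exact abs_nonpos_iff.1 (le_of_forall_gt_imp_ge_of_dense fun ε hε => (hx ε hε).2)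
  have ht := tendsto_measure_biInter_gt (μ := μ) (s := fun ε : ℝ => {x ∈ Q | |g x| ≤ ε}) (a := 0)
    (fun ε _ => (hmeas ε).nullMeasurableSet) (fun i j _ hij x hx => ⟨hx.1, hx.2.trans hij⟩)
    ⟨1, one_pos, ((measure_mono fun x hx => hx.1).trans_lt hQ.measure_lt_top).ne⟩
  rw [hinter, hzero] at ht
  obtain ⟨ε, h1, h2⟩ := ((ht.eventually_lt_const hθ).and self_mem_nhdsWithin).exists
  exact ⟨ε, h2, h1⟩

theorem exists_mul_sq_norm_le_setIntegral_sq {f : ι → X → ℝ} (hf : ∀ i, Continuous (f i))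
    {Q : Set X} (hQ : IsCompact Q)
    (hzero : ∀ c : ι → ℝ, c ≠ 0 → μ {x ∈ Q | ∑ i, c i * f i x = 0} = 0)
    {θ : ℝ} (hθ : 0 < θ) :
    ∃ η : ℝ, 0 < η ∧ ∀ (c : ι → ℝ) (S : Set X), MeasurableSet S → S ⊆ Q →
      ENNReal.ofReal θ ≤ μ S → η * ‖c‖ ^ 2 ≤ ∫ x in S, (∑ i, c i * f i x) ^ 2 ∂μ := by
  have hF : ∀ c : ι → ℝ, Continuous fun x => ∑ i, c i * f i x := fun c => by fun_prop
  obtain ⟨M, hM0, hM⟩ := exists_abs_sum_mul_le_of_isCompact hf hQ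
  obtain ⟨ε, hε, hsmall⟩ : ∃ ε : ℝ, 0 < ε ∧ ∀ c ∈ Metric.sphere (0 : ι → ℝ) 1,
      μ {x ∈ Q | |∑ i, c i * f i x| ≤ ε} ≤ ENNReal.ofReal (θ / 2) := by
    refine (isCompact_sphere (0 : ι → ℝ) 1).induction_on
      (p := fun s => ∃ ε : ℝ, 0 < ε ∧ ∀ c ∈ s,
        μ {x ∈ Q | |∑ i, c i * f i x| ≤ ε} ≤ ENNReal.ofReal (θ / 2))
      ⟨1, one_pos, by simp⟩ ?_ ?_ ?_
    · rintro s t hst ⟨ε, hε, h⟩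
      exact ⟨ε, hε, fun c hc => h c (hst hc)⟩
    · rintro s t ⟨ε, hε, h⟩ ⟨ε', hε', h'⟩
      refine ⟨min ε ε', lt_min hε hε', ?_⟩
      rintro c (hc | hc)
      · exact (measure_mono (Set.ofPred_subset_ofPred.2 fun x hx =>
          ⟨hx.1, hx.2.trans (min_le_left _ _)⟩)).trans (h c hc)
      · exact (measure_mono (Set.ofPred_subset_ofPred.2 fun x hx =>
          ⟨hx.1, hx.2.trans (min_le_right _ _)⟩)).trans (h' c hc)
    · intro c hc
      have hc0 : c ≠ 0 := by rintro rfl; simp at hc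
      obtain ⟨ε, hε, h⟩ := exists_measure_abs_le_lt_of_isCompact (hF c) hQ (hzero c hc0)
        (θ := ENNReal.ofReal (θ / 2)) (by simpa using hθ)
      refine ⟨Metric.ball c (ε / 2 / M),
        mem_nhdsWithin_of_mem_nhds (Metric.ball_mem_nhds _ (by positivity)),
        ε / 2, by positivity, fun c' hc' =>
          (measure_mono (Set.ofPred_subset_ofPred.2 fun x hx => ⟨hx.1, ?_⟩)).trans h.le⟩
      have h1 := hM (c - c') x hx.1
      have h2 : ‖c - c'‖ * M ≤ ε / 2 := by
        rw [Metric.mem_ball, dist_comm, dist_eq_norm, lt_div_iff₀ hM0] at hc'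
        exact hc'.le
      have h3 : ∑ i, c i * f i x = ∑ i, (c - c') i * f i x + ∑ i, c' i * f i x := by
        simp [sub_mul]
      have h4 := hx.2
      change |∑ i, c i * f i x| ≤ ε
      rw [h3]
      exact (abs_add_le _ _).trans (by linarith)
  have hunit : ∀ c : ι → ℝ, ‖c‖ = 1 → ∀ S : Set X, MeasurableSet S → S ⊆ Q →
      ENNReal.ofReal θ ≤ μ S → ε ^ 2 * (θ / 2) ≤ ∫ x in S, (∑ i, c i * f i x) ^ 2 ∂μ := by
    intro c hc S hS hSQ hθS
    have hfin : μ S < ⊤ := (measure_mono hSQ).trans_lt hQ.measure_lt_top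
    have hint : IntegrableOn (fun x => (∑ i, c i * f i x) ^ 2) S μ :=
      (((hF c).pow 2).continuousOn.integrableOn_compact hQ).mono_set hSQ
    have hcheb := mul_meas_ge_le_integral_of_nonneg (μ := μ.restrict S)
      (Filter.Eventually.of_forall fun x => sq_nonneg (∑ i, c i * f i x)) hint (ε ^ 2)
    refine le_trans ?_ hcheb
    gcongr
    have hge : MeasurableSet {x | ε ^ 2 ≤ (∑ i, c i * f i x) ^ 2} :=
      (isClosed_le continuous_const ((hF c).pow 2)).measurableSet
    have hcover : S ⊆ ({x | ε ^ 2 ≤ (∑ i, c i * f i x) ^ 2} ∩ S) ∪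
        {x ∈ Q | |∑ i, c i * f i x| ≤ ε} := by
      intro x hx
      rcases le_total |∑ i, c i * f i x| ε with h | h
      · exact Or.inr ⟨hSQ hx, h⟩
      · refine Or.inl ⟨?_, hx⟩
        rw [Set.mem_ofPred_eq, ← sq_abs (∑ i, c i * f i x)]
        gcongr
    have h1 := hθS.trans ((measure_mono hcover).trans ((measure_union_le _ _).trans
      (add_le_add_right (hsmall c (by simpa using hc)) _)))
    have h2 : μ ({x | ε ^ 2 ≤ (∑ i, c i * f i x) ^ 2} ∩ S) ≠ ⊤ :=
      ((measure_mono Set.inter_subset_right).trans_lt hfin).ne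
    rw [measureReal_def, Measure.restrict_apply hge]
    rw [← ENNReal.ofReal_toReal h2, ← ENNReal.ofReal_add ENNReal.toReal_nonneg (by positivity),
      ENNReal.ofReal_le_ofReal_iff (by positivity)] at h1
    linarith
  refine ⟨ε ^ 2 * (θ / 2), by positivity, fun c S hS hSQ hθS => ?_⟩
  rcases eq_or_ne c 0 with rfl | hc
  · simp
  have hc' : ‖c‖ ≠ 0 := norm_ne_zero_iff.2 hc
  have h := hunit (‖c‖⁻¹ • c) (norm_smul_inv_norm (𝕜 := ℝ) hc) S hS hSQ hθS
  have hscale : ∀ x, (∑ i, (‖c‖⁻¹ • c) i * f i x) ^ 2 =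
      (‖c‖ ^ 2)⁻¹ * (∑ i, c i * f i x) ^ 2 := fun x => by
    simp only [Pi.smul_apply, smul_eq_mul, mul_assoc, ← Finset.mul_sum]
    ring
  simp only [hscale] at h
  rwa [integral_const_mul, ← div_eq_inv_mul, le_div_iff₀ (by positivity)] at h

end FiniteFamily

section Rescaling

variable {E : Type*} [NormedAddCommGroup E] [NormedSpace ℝ E] [MeasurableSpace E] [BorelSpace E]
  [FiniteDimensional ℝ E] (μ : Measure E) [μ.IsAddHaarMeasure]

theorem measure_preimage_add_smul (b : E) {h : ℝ} (hh : 0 < h) (S : Set E) :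
    μ ((fun x => b + h • x) ⁻¹' S) =
      ENNReal.ofReal ((h ^ Module.finrank ℝ E)⁻¹) * μ S := by
  have := Measure.addHaar_preimage_smul μ hh.ne' ((fun x => b + x) ⁻¹' S)
  rw [measure_preimage_add, abs_of_pos (by positivity)] at this
  exact this

theorem setIntegral_preimage_add_smul (b : E) {h : ℝ} (hh : 0 < h) {S : Set E}
    (hS : MeasurableSet S) (g : E → ℝ) :
    ∫ x in (fun x => b + h • x) ⁻¹' S, g (b + h • x) ∂μ =
      (h ^ Module.finrank ℝ E)⁻¹ * ∫ x in S, g x ∂μ := by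
  have hm : Measurable fun x : E => b + h • x := by fun_prop
  rw [← integral_indicator (hm hS), ← integral_indicator hS]
  have := Measure.integral_comp_smul μ (fun x => S.indicator g (b + x)) h
  rw [integral_add_left_eq_self, abs_of_pos (by positivity)] at this
  exact this

end Rescaling

section Box

variable {d : ℕ}

theorem isCompact_setOf_forall_mem_Icc (a b : Fin d → ℝ) :
    IsCompact {y : EuclideanSpace ℝ (Fin d) | ∀ i, y i ∈ Set.Icc (a i) (b i)} := by
  have h : IsCompact (Set.pi Set.univ fun i => Set.Icc (a i) (b i)) :=
    isCompact_univ_pi fun i => isCompact_Icc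
  convert (EuclideanSpace.equiv (Fin d) ℝ).toHomeomorph.isCompact_preimage.2 h using 1
  ext y
  simp [Pi.le_def, forall_and]

theorem volume_euclidean_zeros_eq_zero {p : MvPolynomial (Fin d) ℝ} (hp : p ≠ 0) :
    volume {x : EuclideanSpace ℝ (Fin d) | MvPolynomial.eval (fun i => x i) p = 0} = 0 := by
  have hmeas : MeasurableSet {x : Fin d → ℝ | MvPolynomial.eval x p = 0} :=
    (isClosed_eq (MvPolynomial.continuous_eval p) continuous_const).measurableSet
  have := (PiLp.volume_preserving_ofLp (Fin d)).measure_preimage hmeas.nullMeasurableSet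
  rw [MvPolynomial.volume_zeros_eq_zero hp] at this
  exact this

end Box

theorem MvPolynomial.exists_setIntegral_sq_le (d k : ℕ) {θ : ℝ} (hθ : 0 < θ)
    {Q L : Set (EuclideanSpace ℝ (Fin d))} (hQ : IsCompact Q) (hL : IsCompact L) :
    ∃ C : ℝ, 0 < C ∧ ∀ S ⊆ Q, MeasurableSet S → ENNReal.ofReal θ ≤ volume S →
      ∀ p : MvPolynomial (Fin d) ℝ, (∀ i, p.degreeOf i ≤ k) →
        ∫ x in L, (eval (fun i => x i) p) ^ 2 ≤ C * ∫ x in S, (eval (fun i => x i) p) ^ 2 := by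
  let V := restrictDegree (Fin d) ℝ k
  let e := Module.finBasis ℝ V
  let f := fun i (x : EuclideanSpace ℝ (Fin d)) => eval (fun j => x j) (e i : MvPolynomial (Fin d) ℝ)
  have hf : ∀ i, Continuous (f i) := fun i =>
    (MvPolynomial.continuous_eval _).comp (by fun_prop)
  have hsum : ∀ c : Fin (Module.finrank ℝ V) → ℝ, ∀ x : EuclideanSpace ℝ (Fin d),
      ∑ i, c i * f i x =
        eval (fun j => x j) ((∑ i, c i • e i : V) : MvPolynomial (Fin d) ℝ) := by
    intro c x
    simp [f, smul_eval]
  obtain ⟨M, hM0, hM⟩ := exists_abs_sum_mul_le_of_isCompact hf hL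
  obtain ⟨η, hη, hlow⟩ := exists_mul_sq_norm_le_setIntegral_sq (μ := volume) hf hQ
    (fun c hc => by
      refine measure_mono_null (fun x hx => (hsum c x).symm.trans hx.2)
        (volume_euclidean_zeros_eq_zero fun h0 => hc ?_)
      have h1 : ∑ i, c i • e i = 0 := Subtype.ext h0
      exact _root_.funext (Fintype.linearIndependent_iff.1 e.linearIndependent c h1)) hθ
  refine ⟨M ^ 2 * (volume.real L + 1) / η, by positivity, fun S hSQ hS hθS p hp => ?_⟩
  have hpV : p ∈ V := (mem_restrictDegree _ _ _).2 fun s hs i =>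
    (monomial_le_degreeOf i hs).trans (hp i)
  let c := e.equivFun ⟨p, hpV⟩
  have hpc : ∀ x : EuclideanSpace ℝ (Fin d), eval (fun j => x j) p = ∑ i, c i * f i x := by
    intro x
    rw [hsum, e.sum_equivFun]
  simp only [hpc]
  have hup : ∫ x in L, (∑ i, c i * f i x) ^ 2 ≤ (‖c‖ * M) ^ 2 * volume.real L := by
    refine (Real.le_norm_self _).trans
      (norm_setIntegral_le_of_norm_le_const hL.measure_lt_top fun x hx => ?_)
    rw [norm_pow, Real.norm_eq_abs]
    gcongr
    exact hM c x hx
  calc _ ≤ (‖c‖ * M) ^ 2 * volume.real L := hup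
    _ ≤ M ^ 2 * (volume.real L + 1) / η * (η * ‖c‖ ^ 2) := by
        field_simp
        nlinarith [sq_nonneg (‖c‖ * M)]
    _ ≤ _ := by
        gcongr
        exact hlow c S hS hSQ hθS

theorem stmt_4 (d k : ℕ) (hd : 1 ≤ d) (θ R : ℝ) (hθ0 : 0 < θ) (hθ1 : θ ≤ 1) (hR : 0 ≤ R) :
    ∃ C : ℝ, 0 < C ∧
      ∀ h : ℝ, 0 < h → ∀ a b : EuclideanSpace ℝ (Fin d),
        sInf (Set.image2 dist
            {y : EuclideanSpace ℝ (Fin d) | ∀ i, y i ∈ Set.Icc (a i) (a i + h)}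
            {y : EuclideanSpace ℝ (Fin d) | ∀ i, y i ∈ Set.Icc (b i) (b i + h)}) ≤ R * h →
        ∀ S : Set (EuclideanSpace ℝ (Fin d)), MeasurableSet S →
          S ⊆ {y : EuclideanSpace ℝ (Fin d) | ∀ i, y i ∈ Set.Icc (b i) (b i + h)} →
          ENNReal.ofReal (θ * h ^ d) ≤ volume S →
          ∀ p : MvPolynomial (Fin d) ℝ, (∀ i, p.degreeOf i ≤ k) →
            ∫ y in {y : EuclideanSpace ℝ (Fin d) | ∀ i, y i ∈ Set.Icc (a i) (a i + h)},
                (MvPolynomial.eval (fun i => y i) p) ^ 2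
              ≤ C * ∫ y in S, (MvPolynomial.eval (fun i => y i) p) ^ 2 := by
  have hQ := isCompact_setOf_forall_mem_Icc (d := d) (fun _ => 0) (fun _ => 1)
  have hL := isCompact_setOf_forall_mem_Icc (d := d) (fun _ => -(R + 3)) (fun _ => R + 3)
  obtain ⟨C, hC, hmain⟩ := MvPolynomial.exists_setIntegral_sq_le d k hθ0 hQ hL
  refine ⟨C, hC, fun h hh a b hdist S hS hSb hθS p hp => ?_⟩
  have hm : Measurable fun x : EuclideanSpace ℝ (Fin d) => b + h • x := by fun_prop
  let q := MvPolynomial.bind₁ (fun j => MvPolynomial.C (b j) + MvPolynomial.C h * MvPolynomial.X j) p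
  have hq : ∀ x : EuclideanSpace ℝ (Fin d), MvPolynomial.eval (fun i => x i) q =
      MvPolynomial.eval (fun i => (b + h • x) i) p := fun x => by
    simp [q, MvPolynomial.eval_bind₁_C_add_C_mul_X]
  have hab : ∀ i, |a i - b i| ≤ (R + 2) * h := by
    have hne : (Set.image2 dist
        {y : EuclideanSpace ℝ (Fin d) | ∀ i, y i ∈ Set.Icc (a i) (a i + h)}
        {y : EuclideanSpace ℝ (Fin d) | ∀ i, y i ∈ Set.Icc (b i) (b i + h)}).Nonempty :=
      Set.Nonempty.image2 ⟨a, fun i => by simp [hh.le]⟩ ⟨b, fun i => by simp [hh.le]⟩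
    obtain ⟨_, ⟨y, hy, z, hz, rfl⟩, hyz⟩ :=
      exists_lt_of_csInf_lt hne (hdist.trans_lt (by linarith : R * h < (R + 1) * h))
    intro i
    have h1 : |y i - z i| ≤ dist y z := by
      rw [dist_eq_norm]
      exact PiLp.norm_apply_le (y - z) i
    have h2 := hy i
    have h3 := hz i
    have h4 := abs_le.1 (h1.trans hyz.le)
    rw [Set.mem_Icc] at h2 h3
    exact abs_le.2 ⟨by linarith, by linarith⟩
  have hKL : (fun x => b + h • x) ⁻¹'
      {y : EuclideanSpace ℝ (Fin d) | ∀ i, y i ∈ Set.Icc (a i) (a i + h)} ⊆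
      {y : EuclideanSpace ℝ (Fin d) | ∀ i, y i ∈ Set.Icc (-(R + 3)) (R + 3)} := by
    intro x hx i
    have h1 := hx i
    have h2 := abs_le.1 (hab i)
    simp only [PiLp.add_apply, PiLp.smul_apply, smul_eq_mul, Set.mem_Icc] at h1
    constructor <;> refine le_of_mul_le_mul_left ?_ hh <;> linarith
  have hSQ : (fun x => b + h • x) ⁻¹' S ⊆
      {y : EuclideanSpace ℝ (Fin d) | ∀ i, y i ∈ Set.Icc (0 : ℝ) 1} := by
    intro x hx i
    have h1 := hSb hx i
    simp only [PiLp.add_apply, PiLp.smul_apply, smul_eq_mul, Set.mem_Icc] at h1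
    constructor <;> refine le_of_mul_le_mul_left ?_ hh <;> linarith
  have hvol : ENNReal.ofReal θ ≤ volume ((fun x => b + h • x) ⁻¹' S) := by
    rw [measure_preimage_add_smul volume b hh, finrank_euclideanSpace_fin]
    refine le_trans (le_of_eq ?_) (mul_le_mul_right hθS _)
    rw [← ENNReal.ofReal_mul (by positivity)]
    congr 1
    field_simp
  have hqint : Continuous fun x : EuclideanSpace ℝ (Fin d) =>
      (MvPolynomial.eval (fun i => x i) q) ^ 2 :=
    ((MvPolynomial.continuous_eval q).comp (by fun_prop)).pow 2
  have key := (setIntegral_mono_set (hqint.continuousOn.integrableOn_compact hL)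
    (Filter.Eventually.of_forall fun x => sq_nonneg _) hKL.eventuallyLE).trans
    (hmain _ hSQ (hm hS) hvol q fun i =>
      (MvPolynomial.degreeOf_bind₁_C_add_C_mul_X_le _ h p i).trans (hp i))
  simp only [hq] at key
  rw [setIntegral_preimage_add_smul volume b hh
      (isCompact_setOf_forall_mem_Icc _ _).measurableSet
      (fun y => (MvPolynomial.eval (fun i => y i) p) ^ 2),
    setIntegral_preimage_add_smul volume b hh hS
      (fun y => (MvPolynomial.eval (fun i => y i) p) ^ 2), mul_left_comm] at key
  exact le_of_mul_le_mul_left key (by positivity)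
end

section
/- Let d ≥ 2, k ∈ ℕ, θ ∈ (0,1], L ≥ 0 and R ≥ 0. There exists a constant C > 0, depending only on d, k, θ, L and R, such that for every h > 0, all axis-aligned cubes K, K' ⊆ ℝ^d of side h with dist(K, K') ≤ R·h, every Lebesgue-measurable set S ⊆ K' with λ(S) ≥ θ·h^d, every L-Lipschitz function f : ℝ^{d−1} → ℝ, and every polynomial p of coordinatewise degree at most k, one has h·∫_{Γ_f ∩ K} p² dμH^{d−1} ≤ C·∫_S p² dλ. -/
open MeasureTheory

/-- The zero set of a nonzero real polynomial is Lebesgue-null. -/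
theorem MvPolynomial.volume_zeros_eq_zero_s5 {n : ℕ} {p : MvPolynomial (Fin n) ℝ} (hp : p ≠ 0) :
    volume {x : Fin n → ℝ | MvPolynomial.eval x p = 0} = 0 := by
  induction n with
  | zero =>
    have : {x : Fin 0 → ℝ | MvPolynomial.eval x p = 0} = ∅ := by
      refine Set.eq_empty_of_forall_notMem fun x hx => hp (MvPolynomial.funext fun y => ?_)
      rw [Subsingleton.elim y x, map_zero]
      exact hx
    rw [this, measure_empty]
  | succ n ih =>
    have hP : MvPolynomial.finSuccEquiv ℝ n p ≠ 0 := by simpa using hp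
    obtain ⟨i, hi⟩ : ∃ i, (MvPolynomial.finSuccEquiv ℝ n p).coeff i ≠ 0 := by
      by_contra! h
      exact hP (Polynomial.ext fun i => by simpa using h i)
    have hmeas : MeasurableSet {x : Fin (n + 1) → ℝ | MvPolynomial.eval x p = 0} :=
      (isClosed_eq (MvPolynomial.continuous_eval p) continuous_const).measurableSet
    have he := volume_preserving_piFinSuccAbove (fun _ : Fin (n + 1) => ℝ) 0
    rw [← he.symm.measure_preimage_equiv]
    have hmeas' :=
      (MeasurableEquiv.piFinSuccAbove (fun _ : Fin (n + 1) => ℝ) 0).symm.measurable hmeas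
    rw [Measure.volume_eq_prod, Measure.prod_apply_symm hmeas', 
      ← lintegral_zero (μ := (volume : Measure (Fin n → ℝ)))]
    refine lintegral_congr_ae ?_
    filter_upwards [measure_eq_zero_iff_ae_notMem.mp (ih hi)] with x hx
    have hmap : Polynomial.map (MvPolynomial.eval x) (MvPolynomial.finSuccEquiv ℝ n p) ≠ 0 := by
      intro h
      apply hx
      simpa using congrArg (fun q => Polynomial.coeff q i) h
    refine (Set.Finite.subset (Polynomial.finite_setOfPred_isRoot hmap)
      fun y hy => ?_).measure_zero _
    have hy' : MvPolynomial.eval (Fin.cons y x : Fin (n + 1) → ℝ) p = 0 := by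
      simpa [MeasurableEquiv.piFinSuccAbove, Fin.insertNthEquiv] using hy
    rwa [MvPolynomial.eval_eq_eval_mv_eval'] at hy'

/-- The polynomial function of coordinatewise degree at most `k` with coefficients `c`. -/
def boxPoly {d k : ℕ} (c : (Fin d → Fin (k + 1)) → ℝ) (z : Fin d → ℝ) : ℝ :=
  ∑ α, c α * ∏ i, z i ^ (α i : ℕ)

theorem continuous_boxPoly {d k : ℕ} (c : (Fin d → Fin (k + 1)) → ℝ) :
    Continuous (boxPoly c) := by
  unfold boxPoly
  fun_prop

theorem boxPoly_sub {d k : ℕ} (c c' : (Fin d → Fin (k + 1)) → ℝ) (z : Fin d → ℝ) :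
    boxPoly (c - c') z = boxPoly c z - boxPoly c' z := by
  simp [boxPoly, sub_mul, Finset.sum_sub_distrib]

theorem boxPoly_smul {d k : ℕ} (t : ℝ) (c : (Fin d → Fin (k + 1)) → ℝ) (z : Fin d → ℝ) :
    boxPoly (t • c) z = t * boxPoly c z := by
  simp [boxPoly, Finset.mul_sum, mul_assoc]

theorem abs_boxPoly_le {d k : ℕ} (c : (Fin d → Fin (k + 1)) → ℝ) {B : ℝ} (hB : 1 ≤ B)
    {z : Fin d → ℝ} (hz : ∀ i, |z i| ≤ B) :
    |boxPoly c z| ≤ ((k + 1) ^ d * (B ^ k) ^ d) * ‖c‖ := by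
  have hterm (α : Fin d → Fin (k + 1)) : |c α * ∏ i, z i ^ (α i : ℕ)| ≤ ‖c‖ * (B ^ k) ^ d := by
    rw [abs_mul, Finset.abs_prod]
    refine mul_le_mul (norm_le_pi_norm c α) ?_ (by positivity) (norm_nonneg _)
    calc ∏ i, |z i ^ (α i : ℕ)| ≤ ∏ _i : Fin d, B ^ k := by
          refine Finset.prod_le_prod (fun _ _ => abs_nonneg _) fun i _ => ?_
          rw [abs_pow]
          calc |z i| ^ (α i : ℕ) ≤ B ^ (α i : ℕ) := by gcongr; exact hz i
            _ ≤ B ^ k := pow_le_pow_right₀ hB (Nat.lt_succ_iff.mp (α i).2)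
      _ = (B ^ k) ^ d := by simp
  calc |boxPoly c z| ≤ ∑ α : Fin d → Fin (k + 1), |c α * ∏ i, z i ^ (α i : ℕ)| :=
        Finset.abs_sum_le_sum_abs _ _
    _ ≤ ∑ _α : Fin d → Fin (k + 1), ‖c‖ * (B ^ k) ^ d := Finset.sum_le_sum fun α _ => hterm α
    _ = ((k + 1) ^ d * (B ^ k) ^ d) * ‖c‖ := by
        simp
        ring

theorem volume_zeros_boxPoly {d k : ℕ} {c : (Fin d → Fin (k + 1)) → ℝ} (hc : c ≠ 0) :
    volume {z : Fin d → ℝ | boxPoly c z = 0} = 0 := by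
  let e (α : Fin d → Fin (k + 1)) : Fin d →₀ ℕ :=
    Finsupp.equivFunOnFinite.symm fun i => (α i : ℕ)
  have he : Function.Injective e := fun α β h => by
    funext i
    exact Fin.ext (DFunLike.congr_fun h i)
  let p : MvPolynomial (Fin d) ℝ := ∑ α, MvPolynomial.monomial (e α) (c α)
  have hp : p ≠ 0 := by
    intro h
    refine hc (funext fun α => ?_)
    have := congrArg (MvPolynomial.coeff (e α)) h
    simpa [p, MvPolynomial.coeff_sum, MvPolynomial.coeff_monomial, he.eq_iff] using this
  convert MvPolynomial.volume_zeros_eq_zero_s5 hp using 4 with z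
  simp [p, boxPoly, MvPolynomial.eval_monomial, Finsupp.prod_fintype, e]

/-- An affine change of variables, acting on each coordinate separately, preserves the
coordinatewise degree. -/
theorem MvPolynomial.exists_eval_affine_eq_boxPoly {d k : ℕ} {p : MvPolynomial (Fin d) ℝ}
    (hp : ∀ i, p.degreeOf i ≤ k) (b : Fin d → ℝ) (h : ℝ) :
    ∃ c : (Fin d → Fin (k + 1)) → ℝ,
      ∀ z, MvPolynomial.eval (fun i => b i + h * z i) p = boxPoly c z := by
  have hmono (m : Fin d →₀ ℕ) (hm : m ∈ p.support) (i : Fin d) (t : ℝ) :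
      (b i + h * t) ^ m i =
        ∑ j : Fin (k + 1), ((Polynomial.C (b i) + Polynomial.C h * Polynomial.X) ^ m i).coeff j
          * t ^ (j : ℕ) := by
    have hdeg : ((Polynomial.C (b i) + Polynomial.C h * Polynomial.X) ^ m i).natDegree < k + 1 := by
      refine Nat.lt_succ_of_le ?_
      refine Polynomial.natDegree_pow_le.trans ?_
      have h1 : (Polynomial.C (b i) + Polynomial.C h * Polynomial.X).natDegree ≤ 1 := by
        compute_degree
      calc _ ≤ m i * 1 := Nat.mul_le_mul_left _ h1
        _ ≤ k := by simpa using (MvPolynomial.monomial_le_degreeOf i hm).trans (hp i)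
    have hsum := Polynomial.eval_eq_sum_range' hdeg t
    rw [Finset.sum_range] at hsum
    simpa using hsum
  refine ⟨fun α => ∑ m ∈ p.support, p.coeff m *
    ∏ i, ((Polynomial.C (b i) + Polynomial.C h * Polynomial.X) ^ m i).coeff (α i), fun z => ?_⟩
  rw [MvPolynomial.eval_eq', boxPoly]
  simp_rw [Finset.sum_mul]
  rw [Finset.sum_comm]
  refine Finset.sum_congr rfl fun m hm => ?_
  rw [Finset.prod_congr rfl fun i _ => hmono m hm i (z i), Finset.prod_univ_sum,
    Fintype.piFinset_univ, Finset.mul_sum]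
  exact Finset.sum_congr rfl fun α _ => by rw [Finset.prod_mul_distrib, mul_assoc]

/-- On the unit cube, polynomials with normalised coefficients have uniformly small sublevel
sets. -/
theorem exists_volume_sublevel_boxPoly_lt (d k : ℕ) {η : ENNReal} (hη : 0 < η) :
    ∃ ε : ℝ, 0 < ε ∧ ∀ c : (Fin d → Fin (k + 1)) → ℝ, ‖c‖ = 1 →
      volume {z : Fin d → ℝ | z ∈ Set.Icc 0 1 ∧ |boxPoly c z| ≤ ε} < η := by
  have key : ∃ ε : ℝ, 0 < ε ∧ ∀ c ∈ Metric.sphere (0 : (Fin d → Fin (k + 1)) → ℝ) 1,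
      volume {z : Fin d → ℝ | z ∈ Set.Icc 0 1 ∧ |boxPoly c z| ≤ ε} < η := by
    refine (isCompact_sphere (0 : (Fin d → Fin (k + 1)) → ℝ) 1).induction_on
      (p := fun s => ∃ ε : ℝ, 0 < ε ∧ ∀ c ∈ s,
        volume {z : Fin d → ℝ | z ∈ Set.Icc 0 1 ∧ |boxPoly c z| ≤ ε} < η) ⟨1, one_pos, by simp⟩
      ?_ ?_ ?_
    · rintro s t hst ⟨ε, hε, h⟩
      exact ⟨ε, hε, fun c hc => h c (hst hc)⟩
    · rintro s t ⟨ε, hε, h⟩ ⟨ε', hε', h'⟩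
      refine ⟨min ε ε', lt_min hε hε', fun c hc => ?_⟩
      rcases hc with hc | hc
      · exact (measure_mono (Set.ofPred_subset_ofPred.2 fun z hz =>
          ⟨hz.1, hz.2.trans (min_le_left _ _)⟩)).trans_lt (h c hc)
      · exact (measure_mono (Set.ofPred_subset_ofPred.2 fun z hz =>
          ⟨hz.1, hz.2.trans (min_le_right _ _)⟩)).trans_lt (h' c hc)
    · intro c hc
      have hc0 : c ≠ 0 := by
        rintro rfl
        simp at hc
      let s (n : ℕ) : Set (Fin d → ℝ) := {z | z ∈ Set.Icc 0 1 ∧ |boxPoly c z| ≤ 1 / ((n : ℝ) + 1)}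
      have hs (n : ℕ) : MeasurableSet (s n) :=
        (isClosed_Icc.inter
          (isClosed_le (continuous_boxPoly c).abs continuous_const)).measurableSet
      have hanti : Antitone s := fun m n hmn z hz =>
        ⟨hz.1, hz.2.trans (one_div_le_one_div_of_le (by positivity) (by gcongr))⟩
      have hfin : volume (s 0) ≠ ⊤ :=
        ne_top_of_le_ne_top (isCompact_Icc (a := (0 : Fin d → ℝ)) (b := 1)).measure_ne_top
          (measure_mono fun z hz => hz.1)
      have hlim := tendsto_measure_iInter_atTop (fun n => (hs n).nullMeasurableSet) hanti
        ⟨0, hfin⟩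
      have hzero : volume (⋂ n, s n) = 0 := by
        refine measure_mono_null (fun z hz => ?_) (volume_zeros_boxPoly hc0)
        rw [Set.mem_iInter] at hz
        have : |boxPoly c z| ≤ 0 :=
          ge_of_tendsto' (tendsto_one_div_add_atTop_nhds_zero_nat (𝕜 := ℝ)) fun n => (hz n).2
        exact abs_nonpos_iff.mp this
      rw [hzero] at hlim
      obtain ⟨n, hn⟩ := (hlim.eventually_lt_const hη).exists
      set ε : ℝ := 1 / ((n : ℝ) + 1) with hε
      have hε0 : 0 < ε := by positivity
      set N : ℝ := ((k : ℝ) + 1) ^ d * ((1 : ℝ) ^ k) ^ d with hN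
      have hN0 : 0 < N := by positivity
      refine ⟨Metric.ball c (ε / 2 / N), mem_nhdsWithin_of_mem_nhds
        (Metric.ball_mem_nhds c (by positivity)), ε / 2, by positivity, fun c' hc' => ?_⟩
      refine (measure_mono (Set.ofPred_subset_ofPred.2 fun z hz => ⟨hz.1, ?_⟩)).trans_lt hn
      have hdiff : |boxPoly c' z - boxPoly c z| ≤ ε / 2 := by
        rw [← boxPoly_sub]
        refine (abs_boxPoly_le (c' - c) le_rfl fun i => ?_).trans ?_
        · rw [abs_of_nonneg (hz.1.1 i)]
          exact hz.1.2 i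
        · rw [← hN, ← le_div_iff₀' hN0, ← dist_eq_norm]
          exact (Metric.mem_ball.mp hc').le
      have := abs_sub_abs_le_abs_sub (boxPoly c z) (boxPoly c' z)
      rw [abs_sub_comm] at this
      linarith [hz.2]
  obtain ⟨ε, hε, h⟩ := key
  exact ⟨ε, hε, fun c hc => h c (by simpa using hc)⟩

theorem volume_preimage_rescale {d : ℕ} (b : EuclideanSpace ℝ (Fin d)) {h : ℝ} (hh : 0 < h)
    {B : Set (Fin d → ℝ)} (hB : MeasurableSet B) :
    volume {y : EuclideanSpace ℝ (Fin d) | (fun i => h⁻¹ * (y i - b i)) ∈ B} =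
      ENNReal.ofReal (h ^ d) * volume B := by
  have hB' : MeasurableSet ((fun w : Fin d → ℝ => h⁻¹ • w) ⁻¹' B) :=
    (measurable_const_smul h⁻¹) hB
  have hB'' := (measurePreserving_sub_right volume (b.ofLp)).measurable hB'
  have h1 := (PiLp.volume_preserving_ofLp (Fin d)).measure_preimage hB''.nullMeasurableSet
  rw [(measurePreserving_sub_right volume (b.ofLp)).measure_preimage hB'.nullMeasurableSet,
    Measure.addHaar_preimage_smul volume (inv_ne_zero hh.ne')] at h1
  refine h1.trans ?_
  simp [abs_of_pos hh]

theorem volume_cube_ne_top {d : ℕ} (b : EuclideanSpace ℝ (Fin d)) {h : ℝ} (hh : 0 < h) :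
    volume {x : EuclideanSpace ℝ (Fin d) | ∀ i, x i ∈ Set.Icc (b i) (b i + h)} ≠ ⊤ := by
  have hset : {x : EuclideanSpace ℝ (Fin d) | ∀ i, x i ∈ Set.Icc (b i) (b i + h)} =
      {x | (fun i => h⁻¹ * (x i - b i)) ∈ Set.Icc (0 : Fin d → ℝ) 1} := by
    ext x
    simp only [Set.mem_ofPred_eq, Set.mem_Icc, Pi.le_def, Pi.zero_apply, Pi.one_apply,
      ← forall_and]
    refine forall_congr' fun i => and_congr ?_ ?_
    · rw [le_inv_mul_iff₀ hh, mul_zero, sub_nonneg]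
    · rw [inv_mul_le_iff₀ hh, mul_one, sub_le_iff_le_add']
  rw [hset, volume_preimage_rescale b hh measurableSet_Icc]
  exact ENNReal.mul_ne_top ENNReal.ofReal_ne_top isCompact_Icc.measure_ne_top

set_option maxHeartbeats 400000 in
/-- A Remez-type inequality: a polynomial of bounded coordinatewise degree is controlled on a
neighbourhood of a cube by its `L²`-norm on a subset of the cube of substantial measure. -/
theorem exists_sq_eval_le_setIntegral (d k : ℕ) {θ : ℝ} (hθ : 0 < θ) (ρ : ℝ) :
    ∃ A : ℝ, 0 < A ∧ ∀ h : ℝ, 0 < h → ∀ b : EuclideanSpace ℝ (Fin d),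
      ∀ S : Set (EuclideanSpace ℝ (Fin d)), MeasurableSet S →
        S ⊆ {y | ∀ i, y i ∈ Set.Icc (b i) (b i + h)} →
        ENNReal.ofReal (θ * h ^ d) ≤ volume S →
        ∀ p : MvPolynomial (Fin d) ℝ, (∀ i, p.degreeOf i ≤ k) →
          ∀ y : EuclideanSpace ℝ (Fin d), (∀ i, |y i - b i| ≤ ρ * h) →
            h ^ d * (MvPolynomial.eval (fun i => y i) p) ^ 2 ≤
              A * ∫ x in S, (MvPolynomial.eval (fun i => x i) p) ^ 2 := by
  obtain ⟨ε, hε, hsub⟩ := exists_volume_sublevel_boxPoly_lt d k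
    (η := ENNReal.ofReal (θ / 2)) (by simpa using hθ)
  set N : ℝ := ((k : ℝ) + 1) ^ d * ((max 1 ρ) ^ k) ^ d with hN
  have hN0 : 0 < N := by positivity
  refine ⟨2 * N ^ 2 / (ε ^ 2 * θ), by positivity, ?_⟩
  intro h hh b S hS hSb hSθ p hp y hy
  obtain ⟨c, hc⟩ := p.exists_eval_affine_eq_boxPoly hp b h
  have heval (x : EuclideanSpace ℝ (Fin d)) :
      MvPolynomial.eval (fun i => x i) p = boxPoly c (fun i => h⁻¹ * (x i - b i)) := by
    rw [← hc]
    congr 1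
    congr 1
    funext i
    field_simp
    ring
  have hcont : Continuous fun x : EuclideanSpace ℝ (Fin d) =>
      MvPolynomial.eval (fun i => x i) p :=
    (MvPolynomial.continuous_eval p).comp (PiLp.continuous_ofLp 2 _)
  have hpy : (MvPolynomial.eval (fun i => y i) p) ^ 2 ≤ (N * ‖c‖) ^ 2 := by
    rw [heval, sq_le_sq, abs_of_nonneg (a := N * ‖c‖) (by positivity)]
    refine abs_boxPoly_le c (le_max_left _ _) fun i => le_max_of_le_right ?_
    rw [abs_mul, abs_of_pos (inv_pos.mpr hh), inv_mul_le_iff₀ hh, mul_comm h]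
    exact hy i
  have hSfin : volume S ≠ ⊤ := ne_top_of_le_ne_top (volume_cube_ne_top b hh) (measure_mono hSb)
  have hint : IntegrableOn (fun x : EuclideanSpace ℝ (Fin d) =>
      (MvPolynomial.eval (fun i => x i) p) ^ 2) S := by
    refine Measure.integrableOn_of_bounded (M := (((k : ℝ) + 1) ^ d * ((1 : ℝ) ^ k) ^ d * ‖c‖) ^ 2)
      hSfin (hcont.pow 2).aestronglyMeasurable ?_
    filter_upwards [ae_restrict_mem hS] with x hx
    rw [Real.norm_eq_abs, abs_pow]
    gcongr
    rw [heval]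
    refine abs_boxPoly_le c le_rfl fun i => ?_
    have := hSb hx i
    rw [abs_mul, abs_of_pos (inv_pos.mpr hh), inv_mul_le_iff₀ hh,
      abs_of_nonneg (by linarith [this.1])]
    linarith [this.2]
  rcases eq_or_ne c 0 with rfl | hc0
  · have hz : MvPolynomial.eval (fun i => y i) p = 0 := by
      rw [heval]
      simp [boxPoly]
    rw [hz]
    have : 0 ≤ ∫ x in S, (MvPolynomial.eval (fun i => x i) p) ^ 2 :=
      integral_nonneg fun x => sq_nonneg _
    simp only [ne_eq, OfNat.ofNat_ne_zero, not_false_eq_true, zero_pow, mul_zero]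
    positivity
  have ht : 0 < ‖c‖ := norm_pos_iff.mpr hc0
  have hlt := hsub (‖c‖⁻¹ • c) (by rw [norm_smul, norm_inv, norm_norm, inv_mul_cancel₀ ht.ne'])
  set B : Set (Fin d → ℝ) := {z | z ∈ Set.Icc 0 1 ∧ |boxPoly (‖c‖⁻¹ • c) z| ≤ ε} with hBdef
  have hB : MeasurableSet B :=
    (isClosed_Icc.inter (isClosed_le (continuous_boxPoly _).abs continuous_const)).measurableSet
  set T : Set (EuclideanSpace ℝ (Fin d)) := {x | (fun i => h⁻¹ * (x i - b i)) ∈ B} with hT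
  have hTvol : volume T ≤ ENNReal.ofReal (h ^ d * (θ / 2)) := by
    rw [volume_preimage_rescale b hh hB, ENNReal.ofReal_mul (by positivity)]
    gcongr
  have hTmeas : MeasurableSet T := by
    refine (show Continuous fun x : EuclideanSpace ℝ (Fin d) =>
      (fun i => h⁻¹ * (x i - b i) : Fin d → ℝ) by fun_prop).measurable hB
  have hdiff : θ / 2 * h ^ d ≤ volume.real (S \ T) := by
    have h1 : ENNReal.ofReal (θ / 2 * h ^ d) ≤ volume (S \ T) := by
      refine le_trans ?_ (le_measure_sdiff (μ := volume) (s₁ := S) (s₂ := T))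
      refine le_trans ?_ (tsub_le_tsub hSθ hTvol)
      rw [← ENNReal.ofReal_sub _ (by positivity)]
      exact ENNReal.ofReal_le_ofReal (by linarith)
    exact (ENNReal.ofReal_le_iff_le_toReal
      (ne_top_of_le_ne_top hSfin (measure_mono Set.sdiff_subset))).mp h1
  have hbound : ∀ x ∈ S \ T, (ε * ‖c‖) ^ 2 ≤ (MvPolynomial.eval (fun i => x i) p) ^ 2 := by
    rintro x ⟨hxS, hxT⟩
    rw [sq_le_sq, abs_of_pos (by positivity : 0 < ε * ‖c‖), heval]
    by_contra! hlt'
    refine hxT ⟨⟨fun i => ?_, fun i => ?_⟩, ?_⟩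
    · exact mul_nonneg (inv_pos.mpr hh).le (sub_nonneg.mpr (hSb hxS i).1)
    · show h⁻¹ * (x i - b i) ≤ 1
      rw [inv_mul_le_iff₀ hh]
      linarith [(hSb hxS i).2]
    · rw [boxPoly_smul, abs_mul, abs_of_pos (inv_pos.mpr ht), inv_mul_le_iff₀ ht, mul_comm]
      exact hlt'.le
  have hlow : (ε * ‖c‖) ^ 2 * (θ / 2 * h ^ d) ≤
      ∫ x in S, (MvPolynomial.eval (fun i => x i) p) ^ 2 := by
    calc (ε * ‖c‖) ^ 2 * (θ / 2 * h ^ d) ≤ (ε * ‖c‖) ^ 2 * volume.real (S \ T) := by gcongr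
      _ ≤ ∫ x in S \ T, (MvPolynomial.eval (fun i => x i) p) ^ 2 :=
        setIntegral_ge_of_const_le_real (hS.diff hTmeas)
          (ne_top_of_le_ne_top hSfin (measure_mono Set.sdiff_subset)) hbound
          (hint.mono_set Set.sdiff_subset)
      _ ≤ _ := setIntegral_mono_set hint (ae_of_all _ fun x => sq_nonneg _)
        (Set.sdiff_subset.eventuallyLE)
  calc h ^ d * (MvPolynomial.eval (fun i => y i) p) ^ 2 ≤ h ^ d * (N * ‖c‖) ^ 2 := by gcongr
    _ = 2 * N ^ 2 / (ε ^ 2 * θ) * ((ε * ‖c‖) ^ 2 * (θ / 2 * h ^ d)) := by field_simp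
    _ ≤ _ := by gcongr

/-- The part of an `L`-Lipschitz graph inside a cube of side `h` has surface measure at most a
constant multiple of `h ^ (d - 1)`. -/
theorem exists_hausdorffMeasure_graph_inter_cube_le {d : ℕ} (hd : 2 ≤ d) {l : Fin d}
    (hl : (l : ℕ) = d - 1) {L : ℝ} (hL : 0 ≤ L) :
    ∃ M : ℝ, 0 < M ∧ ∀ h : ℝ, 0 < h → ∀ a : EuclideanSpace ℝ (Fin d),
      ∀ f : EuclideanSpace ℝ (Fin (d - 1)) → ℝ, (∀ x y, |f x - f y| ≤ L * dist x y) →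
        (μH[(d : ℝ) - 1] : Measure (EuclideanSpace ℝ (Fin d)))
          ({y | ∃ x : EuclideanSpace ℝ (Fin (d - 1)),
              (∀ i : Fin (d - 1), y (Fin.castLE (Nat.sub_le d 1) i) = x i) ∧
              y l = f x} ∩
            {y | ∀ i, y i ∈ Set.Icc (a i) (a i + h)}) ≤ ENNReal.ofReal (M * h ^ (d - 1)) := by
  have hdim : (d : ℝ) - 1 = (Fintype.card (Fin (d - 1)) : ℝ) := by
    rw [Fintype.card_fin, Nat.cast_sub (by omega), Nat.cast_one]
  let κ : NNReal := (Fintype.card (Fin (d - 1)) : NNReal) ^ (1 / (2 : ENNReal)).toReal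
  let κ' : NNReal := (Fintype.card (Fin d) : NNReal) ^ (1 / (2 : ENNReal)).toReal
  let Λ : NNReal := κ' * max 1 (L.toNNReal * κ)
  refine ⟨(Λ : ℝ) ^ (d - 1) + 1, by positivity, fun h hh a f hf => ?_⟩
  have hfL : LipschitzWith (L.toNNReal * κ) fun w : Fin (d - 1) → ℝ => f (WithLp.toLp 2 w) := by
    refine LipschitzWith.comp (g := WithLp.toLp 2) (f := f) (.of_dist_le_mul fun x y => ?_)
      (PiLp.lipschitzWith_toLp 2 _)
    rw [Real.dist_eq, Real.coe_toNNReal L hL]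
    exact hf x y
  let g (w : Fin (d - 1) → ℝ) (i : Fin d) : ℝ :=
    if hi : (i : ℕ) < d - 1 then w ⟨i, hi⟩ else f (WithLp.toLp 2 w)
  have hg : LipschitzWith (max 1 (L.toNNReal * κ)) g := by
    refine LipschitzWith.of_dist_le_mul fun w w' => ?_
    refine (dist_pi_le_iff (by positivity)).mpr fun i => ?_
    by_cases hi : (i : ℕ) < d - 1
    · simp only [g, hi, dite_true]
      calc dist (w ⟨i, hi⟩) (w' ⟨i, hi⟩) ≤ 1 * dist w w' := by
            rw [one_mul]
            exact dist_le_pi_dist w w' _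
        _ ≤ _ := by gcongr; simp
    · simp only [g, hi, dite_false]
      refine (hfL.dist_le_mul w w').trans ?_
      gcongr
      exact le_max_right _ _
  have hG : LipschitzWith Λ fun w => WithLp.toLp 2 (g w) :=
    (PiLp.lipschitzWith_toLp 2 fun _ : Fin d => ℝ).comp hg
  let Q : Set (Fin (d - 1) → ℝ) :=
    Set.Icc (fun i => a (Fin.castLE (Nat.sub_le d 1) i))
      (fun i => a (Fin.castLE (Nat.sub_le d 1) i) + h)
  refine (measure_mono (t := (fun w => WithLp.toLp 2 (g w)) '' Q) ?_).trans ?_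
  · rintro y ⟨⟨x, hx, hxf⟩, hy⟩
    refine ⟨x.ofLp, ⟨fun i => ?_, fun i => ?_⟩, ?_⟩
    · rw [← hx]
      exact (hy _).1
    · rw [← hx]
      exact (hy _).2
    · ext i
      by_cases hi : (i : ℕ) < d - 1
      · simp only [g, hi, dite_true]
        exact (hx ⟨i, hi⟩).symm
      · have hi' : i = l := Fin.ext (by omega)
        simp only [g, hi, dite_false]
        rw [hi']
        exact hxf.symm
  · refine (hG.hausdorffMeasure_image_le (by rw [hdim]; positivity) Q).trans ?_
    rw [hdim, hausdorffMeasure_pi_real, Real.volume_Icc_pi]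
    simp only [add_sub_cancel_left, Finset.prod_const, Finset.card_univ, Fintype.card_fin,
      ENNReal.rpow_natCast]
    rw [← ENNReal.ofReal_pow hh.le, ← ENNReal.ofReal_coe_nnreal,
      ← ENNReal.ofReal_pow (by positivity),
      ← ENNReal.ofReal_mul (by positivity)]
    refine ENNReal.ofReal_le_ofReal ?_
    gcongr
    linarith



/-- weighted trace stability of polynomial extrapolation: if `K, K'` are
axis-aligned cubes of side `h` at distance at most `R·h`, `S ⊆ K'` has measure at least
`θ·h^d`, and `Γ_f` is a Lipschitz graph, then the `h`-weighted interface `L²`-norm over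
`Γ_f ∩ K` of any polynomial of coordinatewise degree at most `k` is controlled by its
`L²`-norm over `S`. -/
theorem stmt_5 (d k : ℕ) (hd : 2 ≤ d) (θ L R : ℝ) (hθ0 : 0 < θ) (hθ1 : θ ≤ 1)
    (hL : 0 ≤ L) (hR : 0 ≤ R) :
    ∃ C : ℝ, 0 < C ∧
      ∀ h : ℝ, 0 < h → ∀ a b : EuclideanSpace ℝ (Fin d),
        sInf (Set.image2 dist
            {y : EuclideanSpace ℝ (Fin d) | ∀ i, y i ∈ Set.Icc (a i) (a i + h)}
            {y : EuclideanSpace ℝ (Fin d) | ∀ i, y i ∈ Set.Icc (b i) (b i + h)}) ≤ R * h →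
        ∀ S : Set (EuclideanSpace ℝ (Fin d)), MeasurableSet S →
          S ⊆ {y : EuclideanSpace ℝ (Fin d) | ∀ i, y i ∈ Set.Icc (b i) (b i + h)} →
          ENNReal.ofReal (θ * h ^ d) ≤ volume S →
          ∀ f : EuclideanSpace ℝ (Fin (d - 1)) → ℝ,
            (∀ x y : EuclideanSpace ℝ (Fin (d - 1)), |f x - f y| ≤ L * dist x y) →
            ∀ p : MvPolynomial (Fin d) ℝ, (∀ i, p.degreeOf i ≤ k) →
              h *
                  ∫ y in
                      ({y : EuclideanSpace ℝ (Fin d) |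
                          ∃ x : EuclideanSpace ℝ (Fin (d - 1)),
                            (∀ i : Fin (d - 1), y (Fin.castLE (Nat.sub_le d 1) i) = x i) ∧
                            y ⟨d - 1, by omega⟩ = f x} ∩
                        {y : EuclideanSpace ℝ (Fin d) | ∀ i, y i ∈ Set.Icc (a i) (a i + h)}),
                    (MvPolynomial.eval (fun i => y i) p) ^ 2 ∂(μH[(d : ℝ) - 1])
                ≤ C * ∫ y in S, (MvPolynomial.eval (fun i => y i) p) ^ 2 := by
  obtain ⟨A, hA, hpoint⟩ := exists_sq_eval_le_setIntegral d k hθ0 (R + 3)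
  obtain ⟨M, hM, hgraph⟩ := exists_hausdorffMeasure_graph_inter_cube_le hd
    (l := ⟨d - 1, by omega⟩) rfl hL
  refine ⟨A * M, by positivity, fun h hh a b hab S hS hSb hSθ f hf p hp => ?_⟩
  have hne : (Set.image2 dist
      {y : EuclideanSpace ℝ (Fin d) | ∀ i, y i ∈ Set.Icc (a i) (a i + h)}
      {y : EuclideanSpace ℝ (Fin d) | ∀ i, y i ∈ Set.Icc (b i) (b i + h)}).Nonempty :=
    Set.Nonempty.image2 ⟨a, fun i => by simpa using hh.le⟩ ⟨b, fun i => by simpa using hh.le⟩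
  obtain ⟨_, ⟨u, hu, v, hv, rfl⟩, huv⟩ := exists_lt_of_csInf_lt hne
    (hab.trans_lt (show R * h < (R + 1) * h by gcongr; linarith))
  have hnear (y : EuclideanSpace ℝ (Fin d)) (hy : ∀ i, y i ∈ Set.Icc (a i) (a i + h))
      (i : Fin d) : |y i - b i| ≤ (R + 3) * h := by
    have h1 : |u i - v i| ≤ dist u v := by
      simpa [dist_eq_norm] using PiLp.norm_apply_le (u - v) i
    have h2 := abs_le.mp (h1.trans huv.le)
    obtain ⟨hu1, hu2⟩ := hu i
    obtain ⟨hv1, hv2⟩ := hv i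
    obtain ⟨hy1, hy2⟩ := hy i
    rw [abs_le]
    constructor <;> linarith [h2.1, h2.2]
  set I := ∫ y in S, (MvPolynomial.eval (fun i => y i) p) ^ 2 with hI
  have hI0 : 0 ≤ I := integral_nonneg fun x => sq_nonneg _
  have hmeas := hgraph h hh a f hf
  have hreal := ENNReal.toReal_le_of_le_ofReal (by positivity) hmeas
  have hint := norm_setIntegral_le_of_norm_le_const (hmeas.trans_lt ENNReal.ofReal_lt_top)
    (f := fun y : EuclideanSpace ℝ (Fin d) => (MvPolynomial.eval (fun i => y i) p) ^ 2)
    (C := A * I / h ^ d) fun y hy => by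
      rw [Real.norm_of_nonneg (sq_nonneg _), le_div_iff₀' (by positivity)]
      exact hpoint h hh b S hS hSb hSθ p hp y (hnear y hy.2)
  have hpow : h ^ d = h * h ^ (d - 1) := by rw [← pow_succ', Nat.sub_add_cancel (by omega)]
  calc _ ≤ h * (A * I / h ^ d * (M * h ^ (d - 1))) := by
        gcongr
        exact (le_abs_self _).trans (hint.trans (by gcongr; exact hreal))
    _ = A * M * I := by
        rw [hpow]
        field_simp
end

section
/- Let N ≥ 1 and, for each index i ∈ {0, …, N}, let (V_i, ‖·‖_{V_i}) and (Q_i, ‖·‖_{Q_i}) be real normed vector spaces and b_i : V_i × Q_i → ℝ a bilinear map. Assume there exist constants C₁, C₂ > 0 such that for every i and every q_i ∈ Q_i there exists v_i ∈ V_i with b_i(v_i, q_i) ≥ C₁·‖q_i‖²_{Q_i} and ‖v_i‖_{V_i} ≤ C₂·‖q_i‖_{Q_i}. Let V := Π_{i=0}^N V_i and Q := Π_{i=0}^N Q_i be the product vector spaces, equipped with norms ‖·‖_V and ‖·‖_Q satisfying, for constants C₃, C₄, c₅ > 0: ‖v‖²_V ≤ C₃·Σ_i ‖v_i‖²_{V_i}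 for every v = (v_0, …, v_N) ∈ V, and c₅·Σ_i ‖q_i‖²_{Q_i} ≤ ‖q‖²_Q ≤ C₄·Σ_i ‖q_i‖²_{Q_i} for every q = (q_0, …, q_N) ∈ Q. Define b(v, q) := Σ_{i=0}^N b_i(v_i, q_i). Then for every q ∈ Q there exists v ∈ V with b(v, q) ≥ (C₁/C₄)·‖q‖²_Q and ‖v‖_V ≤ C₂·√(C₃/c₅)·‖q‖_Q; in particular the inf-sup constant of b with respect to ‖·‖_V and ‖·‖_Q is at least β₀ := (C₁·√c₅)/(C₂·C₄·√C₃) · √(C₄/ C₄) = C₁/(C₂·C₄)·√(c₅/C₃)·C₄^{1/2}·C₄^{-1/2}, i.e. sup_{v ≠ 0} b(v,q)/‖v‖_V ≥ (C₁/(C₂·√(C₃·C₄)))·‖q‖_Q·√(c₅)/√(c₅)·(Σ_i‖q_i‖²)^{1/2}/(Σ_i‖q_i‖²)^{1/2}; concretely, sup_{v ≠ 0} b(v,q)/‖v‖_V ≥ (C₁/(C₂·√(C₃·C₄)))·‖q‖_Q for every q ∈ Q. -/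
/-- glued inf-sup stability. Local inf-sup conditions on each factor, together
with two-sided comparability of the product norms with the Euclidean sums of the local norms,
give a global inf-sup witness: for every `q` there is `v` with
`b(v,q) ≥ (C₁/C₄)·‖q‖_Q²`, `‖v‖_V ≤ C₂·√(C₃/c₅)·‖q‖_Q`, and moreover
`b(v,q) ≥ (C₁/(C₂·√(C₃·C₄)))·‖q‖_Q·‖v‖_V` (the concrete inf-sup bound). -/
theorem stmt_7 (N : ℕ) (hN : 1 ≤ N)
    (V Q : Fin (N + 1) → Type*)
    [∀ i, NormedAddCommGroup (V i)] [∀ i, NormedSpace ℝ (V i)]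
    [∀ i, NormedAddCommGroup (Q i)] [∀ i, NormedSpace ℝ (Q i)]
    (b : ∀ i, V i →ₗ[ℝ] Q i →ₗ[ℝ] ℝ)
    (C₁ C₂ : ℝ) (hC₁ : 0 < C₁) (hC₂ : 0 < C₂)
    (hlocal : ∀ i, ∀ q : Q i, ∃ v : V i, C₁ * ‖q‖ ^ 2 ≤ b i v q ∧ ‖v‖ ≤ C₂ * ‖q‖)
    (nV : (∀ i, V i) → ℝ) (nQ : (∀ i, Q i) → ℝ)
    (hnV0 : ∀ v, 0 ≤ nV v) (hnQ0 : ∀ q, 0 ≤ nQ q)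
    (C₃ C₄ c₅ : ℝ) (hC₃ : 0 < C₃) (hC₄ : 0 < C₄) (hc₅ : 0 < c₅)
    (hnV : ∀ v : ∀ i, V i, (nV v) ^ 2 ≤ C₃ * ∑ i, ‖v i‖ ^ 2)
    (hnQ : ∀ q : ∀ i, Q i,
      c₅ * ∑ i, ‖q i‖ ^ 2 ≤ (nQ q) ^ 2 ∧ (nQ q) ^ 2 ≤ C₄ * ∑ i, ‖q i‖ ^ 2) :
    ∀ q : ∀ i, Q i, ∃ v : ∀ i, V i,
      C₁ / C₄ * (nQ q) ^ 2 ≤ (∑ i, b i (v i) (q i)) ∧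
      nV v ≤ C₂ * Real.sqrt (C₃ / c₅) * nQ q ∧
      C₁ / (C₂ * Real.sqrt (C₃ * C₄)) * nQ q * nV v ≤ ∑ i, b i (v i) (q i) := by
  intro q
  choose v hbv hv using fun i => hlocal i (q i)
  set S : ℝ := ∑ i, ‖q i‖ ^ 2 with hS
  have hS0 : 0 ≤ S := Finset.sum_nonneg fun i _ => sq_nonneg _
  obtain ⟨hlow, hupp⟩ := hnQ q
  rw [← hS] at hlow hupp
  have hb : C₁ * S ≤ ∑ i, b i (v i) (q i) := by
    rw [hS, Finset.mul_sum]
    exact Finset.sum_le_sum fun i _ => hbv i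
  have hsum : ∑ i, ‖v i‖ ^ 2 ≤ C₂ ^ 2 * S := by
    rw [hS, Finset.mul_sum]
    refine Finset.sum_le_sum fun i _ => ?_
    rw [← mul_pow]
    exact pow_le_pow_left₀ (norm_nonneg _) (hv i) 2
  have hnVS : nV v ^ 2 ≤ C₃ * (C₂ ^ 2 * S) :=
    (hnV v).trans (mul_le_mul_of_nonneg_left hsum hC₃.le)
  refine ⟨v, le_trans ?_ hb, ?_, le_trans ?_ hb⟩
  · rw [div_mul_eq_mul_div, div_le_iff₀ hC₄]
    nlinarith
  · have hnQ0q := hnQ0 q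
    refine abs_le_of_sq_le_sq' ?_ (by positivity) |>.2
    rw [mul_pow, mul_pow, Real.sq_sqrt (by positivity)]
    calc nV v ^ 2 ≤ C₃ * (C₂ ^ 2 * S) := hnVS
      _ = C₂ ^ 2 * (C₃ / c₅) * (c₅ * S) := by field_simp
      _ ≤ C₂ ^ 2 * (C₃ / c₅) * nQ q ^ 2 := by gcongr
  · have hprod : nQ q * nV v ≤ C₂ * √(C₃ * C₄) * S := by
      refine abs_le_of_sq_le_sq' ?_ (by positivity) |>.2
      rw [mul_pow, mul_pow, mul_pow, Real.sq_sqrt (by positivity)]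
      calc nQ q ^ 2 * nV v ^ 2 ≤ (C₄ * S) * (C₃ * (C₂ ^ 2 * S)) := by gcongr
        _ = C₂ ^ 2 * (C₃ * C₄) * S ^ 2 := by ring
    rw [mul_assoc, div_mul_eq_mul_div, div_le_iff₀ (by positivity)]
    calc C₁ * (nQ q * nV v) ≤ C₁ * (C₂ * √(C₃ * C₄) * S) := by gcongr
      _ = C₁ * S * (C₂ * √(C₃ * C₄)) := by ring
end

section
/- Let k ≥ 1 and 1 ≤ i ≤ n. For every x ∈ ℝ that is not equal to any knot ξ_j, the function B_{i,k} is differentiable at x and B_{i,k}'(x) = k·( B_{i,k−1}(x)/(ξ_{i+k} − ξ_i) − B_{i+1,k−1}(x)/(ξ_{i+k+1} − ξ_{i+1}) ), with the convention that a quotient whose denominator vanishes equals 0. -/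
/-- The Cox–de Boor B-splines `bspline ξ j i` of degree `j` associated with the knot
sequence `ξ` (1-based indexing of the knots). In Lean division by zero equals zero, so any
term whose denominator vanishes equals `0`, as in the usual convention. -/
noncomputable def bspline (ξ : ℕ → ℝ) : ℕ → ℕ → ℝ → ℝ
  | 0, i, x => if ξ i ≤ x ∧ x < ξ (i + 1) then 1 else 0
  | j + 1, i, x =>
      (x - ξ i) / (ξ (i + j + 1) - ξ i) * bspline ξ j i x
        + (ξ (i + j + 2) - x) / (ξ (i + j + 2) - ξ (i + 1)) * bspline ξ j (i + 1) x

theorem hasDerivAt_bspline_zero (ξ : ℕ → ℝ) (i : ℕ) {x : ℝ} (h₀ : x ≠ ξ i) (h₁ : x ≠ ξ (i + 1)) :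
    HasDerivAt (bspline ξ 0 i) 0 x := by
  refine (hasDerivAt_const x (bspline ξ 0 i x)).congr_of_eventuallyEq ?_
  have near_iff {a : ℝ} (ha : x ≠ a) : ∀ᶠ y in nhds x, (a ≤ y ↔ a ≤ x) := by
    rcases lt_or_gt_of_ne ha with h | h
    · filter_upwards [eventually_lt_nhds h] with y hy
      simp only [hy.not_ge, h.not_ge]
    · filter_upwards [eventually_gt_nhds h] with y hy
      simp only [le_of_lt hy, le_of_lt h]
  filter_upwards [near_iff h₀, near_iff h₁] with y hy₀ hy₁
  simp only [bspline, ← not_le, hy₀, hy₁]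

/-- The Leibniz terms in the derivative of the Cox–de Boor recursion, written in terms of
B-splines `a`, `b`, `c` of one degree lower; `s₀, s₁, s₂` are the first and `t₀, t₁, t₂` the last
knots of their supports. -/
theorem bspline_leibniz_identity {x s₀ s₁ s₂ t₀ t₁ t₂ a b c : ℝ}
    (hs : s₀ ≤ s₁) (hst : s₁ ≤ t₁) (ht : t₁ ≤ t₂) :
    (x - s₀) / (t₁ - s₀) * (a / (t₀ - s₀) - b / (t₁ - s₁))
        + (t₂ - x) / (t₂ - s₁) * (b / (t₁ - s₁) - c / (t₂ - s₂))
      = ((x - s₀) / (t₀ - s₀) * a + (t₁ - x) / (t₁ - s₁) * b) / (t₁ - s₀)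
        - ((x - s₁) / (t₁ - s₁) * b + (t₂ - x) / (t₂ - s₂) * c) / (t₂ - s₁) := by
  rcases hst.eq_or_lt with rfl | h
  · simp only [sub_self, div_zero]
    ring
  · have h₀ : (t₁ - s₀) * (t₁ - s₀)⁻¹ = 1 := mul_inv_cancel₀ (by linarith)
    have h₁ : (t₂ - s₁) * (t₂ - s₁)⁻¹ = 1 := mul_inv_cancel₀ (by linarith)
    simp only [div_eq_mul_inv]
    linear_combination b * (t₁ - s₁)⁻¹ * (h₁ - h₀)

theorem hasDerivAt_bspline_succ (ξ : ℕ → ℝ) (x : ℝ) (p i : ℕ)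
    (hξ : MonotoneOn ξ (Set.Icc i (i + p + 2)))
    (hx : ∀ j ∈ Set.Icc i (i + p + 2), x ≠ ξ j) :
    HasDerivAt (bspline ξ (p + 1) i)
      ((p + 1 : ℝ) * (bspline ξ p i x / (ξ (i + p + 1) - ξ i)
        - bspline ξ p (i + 1) x / (ξ (i + p + 2) - ξ (i + 1)))) x := by
  have leibniz {p i : ℕ} {d₀ d₁ : ℝ} (h₀ : HasDerivAt (bspline ξ p i) d₀ x)
      (h₁ : HasDerivAt (bspline ξ p (i + 1)) d₁ x) :=
    ((((hasDerivAt_id x).sub_const (ξ i)).div_const (ξ (i + p + 1) - ξ i)).mul h₀).add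
      ((((hasDerivAt_id x).const_sub (ξ (i + p + 2))).div_const
        (ξ (i + p + 2) - ξ (i + 1))).mul h₁)
  induction p generalizing i with
  | zero =>
    have h₀ := hasDerivAt_bspline_zero ξ i (hx i (by simp)) (hx (i + 1) (by simp))
    have h₁ := hasDerivAt_bspline_zero ξ (i + 1) (hx (i + 1) (by simp)) (hx (i + 2) (by simp))
    refine (leibniz h₀ h₁).congr_deriv ?_
    push_cast
    ring
  | succ p ih =>
    have sub₀ : Set.Icc i (i + p + 2) ⊆ Set.Icc i (i + (p + 1) + 2) :=
      Set.Icc_subset_Icc le_rfl (by lia)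
    have sub₁ : Set.Icc (i + 1) (i + 1 + p + 2) ⊆ Set.Icc i (i + (p + 1) + 2) :=
      Set.Icc_subset_Icc (by lia) (by lia)
    have h₀ := ih i (hξ.mono sub₀) fun j hj => hx j (sub₀ hj)
    have h₁ := ih (i + 1) (hξ.mono sub₁) fun j hj => hx j (sub₁ hj)
    have le {a b : ℕ} (ha : i ≤ a) (hab : a ≤ b) (hb : b ≤ i + p + 3) : ξ a ≤ ξ b :=
      hξ ⟨ha, by lia⟩ ⟨by lia, by lia⟩ hab
    have key := bspline_leibniz_identity (x := x) (s₂ := ξ (i + 2)) (t₀ := ξ (i + p + 1))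
      (a := bspline ξ p i x) (b := bspline ξ p (i + 1) x) (c := bspline ξ p (i + 2) x)
      (le (a := i) (b := i + 1) le_rfl (by lia) (by lia))
      (le (b := i + p + 2) (by lia) (by lia) (by lia))
      (le (b := i + p + 3) (by lia) (by lia) (by lia))
    refine (leibniz h₀ h₁).congr_deriv ?_
    have e₁ : i + 1 + p + 1 = i + p + 2 := by lia
    have e₂ : i + 1 + p + 2 = i + p + 3 := by lia
    have e₃ : i + (p + 1) + 1 = i + p + 2 := by lia
    have e₄ : i + (p + 1) + 2 = i + p + 3 := by lia
    have e₅ : i + 1 + 1 = i + 2 := by lia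
    simp only [bspline, e₁, e₂, e₃, e₄, e₅, id_eq]
    push_cast
    linear_combination (p + 1 : ℝ) * key

/-- derivative formula for B-splines: away from the knots, `B_{i,k}` is
differentiable with
`B_{i,k}'(x) = k·(B_{i,k−1}(x)/(ξ_{i+k} − ξ_i) − B_{i+1,k−1}(x)/(ξ_{i+k+1} − ξ_{i+1}))`,
where a quotient with vanishing denominator equals `0`. -/
theorem stmt_13 (k n : ℕ) (hk : 1 ≤ k) (hn : 1 ≤ n) (ξ : ℕ → ℝ)
    (hξ : ∀ i, 1 ≤ i → i ≤ n + k → ξ i ≤ ξ (i + 1)) :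
    ∀ i, 1 ≤ i → i ≤ n → ∀ x : ℝ,
      (∀ j, 1 ≤ j → j ≤ n + k + 1 → x ≠ ξ j) →
      HasDerivAt (bspline ξ k i)
        ((k : ℝ) * (bspline ξ (k - 1) i x / (ξ (i + k) - ξ i)
          - bspline ξ (k - 1) (i + 1) x / (ξ (i + k + 1) - ξ (i + 1)))) x := by
  intro i hi hin x hx
  obtain ⟨p, rfl⟩ := Nat.exists_eq_add_of_le' hk
  have hmono : MonotoneOn ξ (Set.Icc i (i + p + 2)) :=
    monotoneOn_of_le_add_one Set.ordConnected_Icc fun m _ hm hm' =>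
      hξ m (hi.trans hm.1) (by have := hm'.2; lia)
  have hknots : ∀ j ∈ Set.Icc i (i + p + 2), x ≠ ξ j := fun j hj =>
    hx j (hi.trans hj.1) (by have := hj.2; lia)
  simpa [← add_assoc] using hasDerivAt_bspline_succ ξ x p i hmono hknots
end
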